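/- Let D ⊂ ℝ² be a Jordan domain and let f : D → E ⊂ ℝ² be an orientation-preserving homeomorphism onto its image E = f(D). Let C be a connected component of D ∩ E. If f has a periodic orbit entirely contained in C, then f has a fixed point in C. -/

import Mathlib

open Set Filter Topology

noncomputable section

/-- The real plane. -/
abbrev Plane : Type := EuclideanSpace ℝ (Fin 2)

/-- `f` restricted to `X` is a homeomorphism onto its image `Y`
(for compact `X`, a continuous injection is a homeomorphism onto its image). -/
def IsHomeoOnto (f : Plane → Plane) (X Y : Set Plane) : Prop :=
  ContinuousOn f X ∧ Set.InjOn f X ∧ f '' X = Y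

/-- `f : X → f(X)` is isotopic to the identity on `X`: there is a continuous family
of homeomorphisms (continuous injections, `X` being compact in applications)
`h_t : X → h_t(X)`, `t ∈ [0,1]`, with `h_0 = id_X` and `h_1 = f`. -/
def IsotopicToIdOn (f : Plane → Plane) (X : Set Plane) : Prop :=
  ∃ H : ℝ → Plane → Plane,
    ContinuousOn (fun p : ℝ × Plane => H p.1 p.2) (Set.Icc (0:ℝ) 1 ×ˢ X) ∧
    (∀ x ∈ X, H 0 x = x) ∧
    (∀ x ∈ X, H 1 x = f x) ∧
    (∀ t ∈ Set.Icc (0:ℝ) 1, Set.InjOn (H t) X)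

/-- A Jordan domain: a subset of the plane homeomorphic to the closed unit disk. -/
def IsJordanDomain (D : Set Plane) : Prop :=
  Nonempty (↥D ≃ₜ ↥(Metric.closedBall (0:Plane) 1))

/-- A self-homeomorphism of the plane is orientation-preserving iff it is isotopic to
the identity through homeomorphisms of the plane (note that a continuous bijection of the
plane is automatically a homeomorphism, by invariance of domain). -/
def IsOrientationPreservingPlaneHomeo (F : Plane ≃ₜ Plane) : Prop :=
  ∃ H : ℝ → Plane → Plane,
    Continuous (fun p : ℝ × Plane => H p.1 p.2) ∧
    (∀ x, H 0 x = x) ∧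
    (∀ x, H 1 x = F x) ∧
    (∀ t ∈ Set.Icc (0:ℝ) 1, Function.Bijective (H t))

/-- A homeomorphism between planar sets (here: the restriction of `f` to `X`) is
orientation-preserving if it extends to an orientation-preserving homeomorphism of the plane. -/
def OrientationPreservingOn (f : Plane → Plane) (X : Set Plane) : Prop :=
  ∃ F : Plane ≃ₜ Plane, IsOrientationPreservingPlaneHomeo F ∧ Set.EqOn f (⇑F) X

/-- A Jordan curve: the image of a topological embedding of the circle
(a continuous injection of the compact circle, hence an embedding). -/
def IsJordanCurve (C : Set Plane) : Prop :=
  ∃ γ : Plane → Plane, ContinuousOn γ (Metric.sphere (0:Plane) 1) ∧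
    Set.InjOn γ (Metric.sphere (0:Plane) 1) ∧
    γ '' Metric.sphere (0:Plane) 1 = C

theorem exists_log_of_homotopy {X : Type*} [TopologicalSpace X] {S : Set X} {m : ℝ × X → ℂ}
    (hm : ContinuousOn m (Icc (0 : ℝ) 1 ×ˢ S)) (hm0 : ∀ p ∈ Icc (0 : ℝ) 1 ×ˢ S, m p ≠ 0)
    {l : X → ℂ} (hl : ContinuousOn l S) (hl0 : ∀ x ∈ S, Complex.exp (l x) = m (0, x)) :
    ∃ L : ℝ × X → ℂ, ContinuousOn L (Icc (0 : ℝ) 1 ×ˢ S) ∧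
      (∀ p ∈ Icc (0 : ℝ) 1 ×ˢ S, Complex.exp (L p) = m p) ∧ ∀ x ∈ S, L (0, x) = l x := by
  classical
  have hmem : ∀ p : unitInterval × S, ((p.1 : ℝ), (p.2 : X)) ∈ Icc (0 : ℝ) 1 ×ˢ S :=
    fun p => ⟨p.1.2, p.2.2⟩
  let H : C(unitInterval × S, {z : ℂ // z ≠ 0}) :=
    ⟨fun p => ⟨m (p.1, p.2), hm0 _ (hmem p)⟩, by
      refine Continuous.subtype_mk ?_ _
      exact hm.comp_continuous (by fun_prop) hmem⟩
  let f : C(S, ℂ) := ⟨fun x => l x, continuousOn_iff_continuous_domRestrict.1 hl⟩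
  have H0 : ∀ a, H (0, a) = (fun z : ℂ ↦ (⟨_, z.exp_ne_zero⟩ : {z : ℂ // z ≠ 0})) (f a) := by
    intro a
    apply Subtype.ext
    exact (hl0 _ a.2).symm
  let L := Complex.isCoveringMap_exp.liftHomotopy H f H0
  have hL1 := Complex.isCoveringMap_exp.liftHomotopy_lifts H f H0
  have hL0 := Complex.isCoveringMap_exp.liftHomotopy_zero H f H0
  refine ⟨fun p => if h : p ∈ Icc (0 : ℝ) 1 ×ˢ S then L (⟨p.1, h.1⟩, ⟨p.2, h.2⟩) else 0, ?_, ?_, ?_⟩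
  · rw [continuousOn_iff_continuous_domRestrict]
    have : Continuous fun p : (Icc (0 : ℝ) 1 ×ˢ S : Set (ℝ × X)) =>
        L (⟨p.1.1, p.2.1⟩, ⟨p.1.2, p.2.2⟩) := by
      refine L.continuous.comp (Continuous.prodMk ?_ ?_)
      · exact Continuous.subtype_mk (by fun_prop) _
      · exact Continuous.subtype_mk (by fun_prop) _
    convert this using 2 with p
    exact dif_pos p.2
  · intro p hp
    simp only [dif_pos hp]
    exact congrArg Subtype.val (congrFun hL1 (⟨p.1, hp.1⟩, ⟨p.2, hp.2⟩))
  · intro x hx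
    have : ((0 : ℝ), x) ∈ Icc (0 : ℝ) 1 ×ˢ S := ⟨by simp, hx⟩
    simp only [dif_pos this]
    exact hL0 ⟨x, hx⟩

theorem eq_of_exp_eq_one {X : Type*} [TopologicalSpace X] {S : Set X} {f : X → ℂ}
    (hS : IsPreconnected S) (hf : ContinuousOn f S) (h : ∀ x ∈ S, Complex.exp (f x) = 1)
    {x y : X} (hx : x ∈ S) (hy : y ∈ S) : f x = f y := by
  have : PreconnectedSpace S := Subtype.preconnectedSpace hS
  have := Complex.isCoveringMap_exp.isSeparatedMap.const_of_comp
    Complex.isCoveringMap_exp.isLocalHomeomorph.isLocallyInjective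
    (continuousOn_iff_continuous_domRestrict.1 hf) (by
      intro a b
      apply Subtype.ext
      simp [h])
  exact this ⟨x, hx⟩ ⟨y, hy⟩

/-- Functions without zeros on a contractible set have continuous logarithms. -/
theorem exists_log_of_contraction {X : Type*} [TopologicalSpace X] {S : Set X} {g : X → ℂ}
    (hg : ContinuousOn g S) (hg0 : ∀ x ∈ S, g x ≠ 0) {c : ℝ × X → X} {x₀ : X} (hx₀ : x₀ ∈ S)
    (hc : ContinuousOn c (Icc (0 : ℝ) 1 ×ˢ S)) (hcS : ∀ p ∈ Icc (0 : ℝ) 1 ×ˢ S, c p ∈ S)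
    (hc0 : ∀ x ∈ S, c (0, x) = x₀) (hc1 : ∀ x ∈ S, c (1, x) = x) :
    ∃ L : X → ℂ, ContinuousOn L S ∧ ∀ x ∈ S, Complex.exp (L x) = g x := by
  obtain ⟨L, hL, hLe, -⟩ := exists_log_of_homotopy (m := fun p => g (c p))
    (l := fun _ => Complex.log (g x₀)) (S := S) (hg.comp hc hcS) (fun p hp => hg0 _ (hcS p hp)) continuousOn_const (by
      intro x hx
      simp only [hc0 x hx]
      exact Complex.exp_log (hg0 _ hx₀))
  refine ⟨fun x => L (1, x), hL.comp (by fun_prop) (fun x hx => ⟨by simp, hx⟩), fun x hx => ?_⟩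
  rw [hLe (1, x) ⟨by simp, hx⟩, hc1 x hx]

/-- The difference quotient of `F` off the diagonal has a continuous logarithm; this is the form
in which preservation of orientation is used. -/
def IsSecantLog (F : ℂ → ℂ) (l : ℂ × ℂ → ℂ) : Prop :=
  ContinuousOn l {p | p.1 ≠ p.2} ∧
    ∀ a b, a ≠ b → Complex.exp (l (a, b)) = (F a - F b) / (a - b)

/-- The difference quotient of `F` has a continuous logarithm. -/
def HasSecantLog (F : ℂ → ℂ) : Prop := ∃ l, IsSecantLog F l

theorem isPreconnected_offDiag : IsPreconnected {p : ℂ × ℂ | p.1 ≠ p.2} := by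
  have h : IsPreconnected ((univ : Set ℂ) ×ˢ ({0}ᶜ : Set ℂ)) :=
    isPreconnected_univ.prod
      (isConnected_compl_singleton_of_one_lt_rank (by simp) 0).isPreconnected
  have h2 := h.image (fun p => (p.1, p.1 + p.2)) (by fun_prop)
  convert h2 using 1
  ext ⟨a, b⟩
  simp only [mem_ofPred_eq, mem_image, mem_prod, mem_univ, true_and, mem_compl_iff,
    mem_singleton_iff, Prod.mk.injEq, Prod.exists]
  constructor
  · intro hab
    exact ⟨a, b - a, sub_ne_zero.2 (Ne.symm hab), rfl, by ring⟩
  · rintro ⟨c, d, hd, rfl, rfl⟩ h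
    exact hd (by simpa using h)

theorem IsSecantLog.symmetric {F : ℂ → ℂ} {l : ℂ × ℂ → ℂ} (h : IsSecantLog F l) {a b : ℂ}
    (hab : a ≠ b) : l (a, b) = l (b, a) := by
  have hc : ContinuousOn (fun p : ℂ × ℂ => l p - l p.swap) {p | p.1 ≠ p.2} :=
    h.1.sub (h.1.comp continuous_swap.continuousOn (fun p hp => Ne.symm hp))
  have he : ∀ p ∈ {p : ℂ × ℂ | p.1 ≠ p.2}, Complex.exp (l p - l p.swap) = 1 := by
    rintro ⟨x, y⟩ hp
    rw [Complex.exp_sub, h.2 _ _ hp, Prod.swap_prod_mk, h.2 _ _ (Ne.symm hp),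
      ← neg_sub (F x), ← neg_sub x, neg_div_neg_eq]
    refine div_self ?_
    rw [← h.2 _ _ hp]
    exact Complex.exp_ne_zero _
  have := eq_of_exp_eq_one isPreconnected_offDiag hc he (x := (a, b)) (y := (b, a)) hab hab.symm
  simp only [Prod.swap_prod_mk] at this
  have h2 : (2 : ℂ) * (l (a, b) - l (b, a)) = 0 := by linear_combination this
  have h3 := (mul_eq_zero.1 h2).resolve_left two_ne_zero
  exact sub_eq_zero.1 h3

theorem HasSecantLog.trans {F G : ℂ ≃ₜ ℂ} (hF : HasSecantLog F) (hG : HasSecantLog G) :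
    HasSecantLog (F.trans G) := by
  obtain ⟨l, hl, hle⟩ := hF
  obtain ⟨m, hm, hme⟩ := hG
  refine ⟨fun p => l p + m (F p.1, F p.2), hl.add (hm.comp (by fun_prop) ?_), ?_⟩
  · intro p hp h
    exact hp (F.injective h)
  · intro a b hab
    have hF : F a ≠ F b := fun h => hab (F.injective h)
    rw [Complex.exp_add, hle _ _ hab, hme _ _ hF, Homeomorph.trans_apply, Homeomorph.trans_apply]
    rw [mul_comm, div_mul_div_cancel₀ (sub_ne_zero.2 hF)]

theorem HasSecantLog.symm {F : ℂ ≃ₜ ℂ} (hF : HasSecantLog F) : HasSecantLog F.symm := by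
  obtain ⟨l, hl, hle⟩ := hF
  refine ⟨fun p => -l (F.symm p.1, F.symm p.2), (hl.comp (by fun_prop) ?_).neg, ?_⟩
  · intro p hp h
    exact hp (F.symm.injective h)
  · intro a b hab
    have hF : F.symm a ≠ F.symm b := fun h => hab (F.symm.injective h)
    rw [Complex.exp_neg, hle _ _ hF, F.apply_symm_apply, F.apply_symm_apply, inv_div]

theorem hasSecantLog_of_isotopy {F : ℂ → ℂ} {H : ℝ → ℂ → ℂ}
    (hH : Continuous fun p : ℝ × ℂ => H p.1 p.2) (h0 : ∀ x, H 0 x = x) (h1 : ∀ x, H 1 x = F x)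
    (hinj : ∀ t ∈ Icc (0 : ℝ) 1, Function.Injective (H t)) : HasSecantLog F := by
  obtain ⟨L, hL, hLe, -⟩ := exists_log_of_homotopy (X := ℂ × ℂ) (S := {p | p.1 ≠ p.2})
    (m := fun p => (H p.1 p.2.1 - H p.1 p.2.2) / (p.2.1 - p.2.2)) (l := fun _ => 0)
    (by
      refine ContinuousOn.div ?_ (by fun_prop) (fun p hp => sub_ne_zero.2 hp.2)
      refine Continuous.continuousOn (Continuous.sub ?_ ?_)
      · exact hH.comp (g := fun p : ℝ × ℂ => H p.1 p.2) (f := fun p : ℝ × ℂ × ℂ => (p.1, p.2.1))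
          (by fun_prop)
      · exact hH.comp (g := fun p : ℝ × ℂ => H p.1 p.2) (f := fun p : ℝ × ℂ × ℂ => (p.1, p.2.2))
          (by fun_prop))
    (fun p hp => div_ne_zero (sub_ne_zero.2 fun h => hp.2 (hinj _ hp.1 h)) (sub_ne_zero.2 hp.2))
    continuousOn_const
    (fun x hx => by simp [h0, div_self (sub_ne_zero.2 hx)])
  refine ⟨fun p => L (1, p), hL.comp (by fun_prop) (fun x hx => ⟨by simp, hx⟩), fun a b hab => ?_⟩
  rw [hLe (1, (a, b)) ⟨by simp, hab⟩]
  simp [h1]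

/-- A homeomorphism supported in `V` moves `p` to `q`. -/
def CanPush (V : Set ℂ) (p q : ℂ) : Prop :=
  ∃ φ : ℂ ≃ₜ ℂ, HasSecantLog φ ∧ φ p = q ∧ ∀ z, z ∉ V → φ z = z

theorem CanPush.symm {V : Set ℂ} {p q : ℂ} (h : CanPush V p q) : CanPush V q p := by
  obtain ⟨φ, h1, rfl, h3⟩ := h
  exact ⟨φ.symm, h1.symm, by simp, fun z hz => by rw [Homeomorph.symm_apply_eq, h3 z hz]⟩

theorem CanPush.trans {V : Set ℂ} {p q r : ℂ} (h : CanPush V p q) (h' : CanPush V q r) :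
    CanPush V p r := by
  obtain ⟨φ, h1, rfl, h3⟩ := h
  obtain ⟨ψ, h1', rfl, h3'⟩ := h'
  exact ⟨φ.trans ψ, h1.trans h1', rfl, fun z hz => by simp [h3 z hz, h3' z hz]⟩

theorem canPush_of_ball {V : Set ℂ} {p q : ℂ} {ρ : ℝ} (hρ : 0 < ρ)
    (hV : Metric.ball p ρ ⊆ V) (hq : q ∈ Metric.ball p ρ) : CanPush V p q := by
  set v := q - p with hv
  have hvρ : ‖v‖ < ρ := by simpa [hv, dist_eq_norm] using hq
  let b : ℂ → ℝ := fun z => max 0 (1 - ‖z - p‖ / ρ)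
  let g : ℂ → ℂ := fun z => z + b z • v
  have hb : ∀ x y, |b x - b y| ≤ ‖x - y‖ / ρ := by
    intro x y
    have h1 : |b x - b y| ≤ |(1 - ‖x - p‖ / ρ) - (1 - ‖y - p‖ / ρ)| := by
      have := abs_max_sub_max_le_max 0 (1 - ‖x - p‖ / ρ) 0 (1 - ‖y - p‖ / ρ)
      simpa using this
    refine h1.trans ?_
    have : (1 - ‖x - p‖ / ρ) - (1 - ‖y - p‖ / ρ) = (‖y - p‖ - ‖x - p‖) / ρ := by ring
    rw [this, abs_div, abs_of_pos hρ]
    gcongr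
    have := abs_norm_sub_norm_le (y - p) (x - p)
    rwa [sub_sub_sub_cancel_right, norm_sub_rev y x] at this
  have hg : ∀ x y, ‖g x - g y - (x - y)‖ ≤ ‖v‖ / ρ * ‖x - y‖ := by
    intro x y
    have : g x - g y - (x - y) = (b x - b y) • v := by
      simp only [g, sub_smul]; ring
    rw [this, norm_smul, Real.norm_eq_abs]
    calc |b x - b y| * ‖v‖ ≤ ‖x - y‖ / ρ * ‖v‖ := by gcongr; exact hb x y
      _ = ‖v‖ / ρ * ‖x - y‖ := by ring
  have hc1 : ‖v‖ / ρ < 1 := (div_lt_one hρ).2 hvρ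
  have happ : ApproximatesLinearOn g ((ContinuousLinearEquiv.refl ℝ ℂ : ℂ ≃L[ℝ] ℂ) : ℂ →L[ℝ] ℂ)
      univ ⟨‖v‖ / ρ, by positivity⟩ := fun x _ y _ => hg x y
  let φ := happ.toHomeomorph g (Or.inr (by
    have h1 : ‖((ContinuousLinearEquiv.refl ℝ ℂ : ℂ ≃L[ℝ] ℂ).symm : ℂ →L[ℝ] ℂ)‖₊ = 1 := by
      simp
    rw [h1, inv_one]
    exact hc1))
  have hφ : ∀ z, φ z = g z := fun z => rfl
  refine ⟨φ, ⟨fun x => Complex.log ((φ x.1 - φ x.2) / (x.1 - x.2)), ?_, ?_⟩, ?_, ?_⟩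
  · refine ContinuousOn.clog (ContinuousOn.div (by fun_prop) (by fun_prop)
      (fun x hx => sub_ne_zero.2 hx)) ?_
    rintro ⟨x, y⟩ hxy
    have hxy' : x - y ≠ 0 := sub_ne_zero.2 hxy
    have : (φ x - φ y) / (x - y) = 1 + (g x - g y - (x - y)) / (x - y) := by
      rw [hφ, hφ]; field_simp; ring
    simp only
    rw [this]
    refine Complex.mem_slitPlane_of_norm_lt_one ?_
    rw [norm_div, div_lt_one (norm_pos_iff.2 hxy')]
    calc _ ≤ ‖v‖ / ρ * ‖x - y‖ := hg x y
      _ < 1 * ‖x - y‖ := by gcongr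
      _ = _ := one_mul _
  · intro x y hxy
    refine Complex.exp_log (div_ne_zero (sub_ne_zero.2 fun h => hxy (φ.injective h))
      (sub_ne_zero.2 hxy))
  · simp [hφ, g, b, hv]
  · intro z hz
    have : ρ ≤ ‖z - p‖ := by
      by_contra h
      push Not at h
      exact hz (hV (by simpa [dist_eq_norm] using h))
    have : 1 ≤ ‖z - p‖ / ρ := (one_le_div hρ).2 this
    have hb0 : b z = 0 := max_eq_left (by linarith)
    simp [hφ, g, hb0]

theorem canPush_of_isPreconnected {V : Set ℂ} (hV : IsOpen V) (hc : IsPreconnected V) {p q : ℂ}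
    (hp : p ∈ V) (hq : q ∈ V) : CanPush V p q := by
  refine hc.induction₂ (CanPush V) ?_ (fun _ _ _ _ _ _ h h' => h.trans h')
    (fun _ _ _ _ h => h.symm) hp hq
  intro x hx
  obtain ⟨ρ, hρ, hb⟩ := Metric.isOpen_iff.1 hV x hx
  filter_upwards [mem_nhdsWithin_of_mem_nhds (Metric.ball_mem_nhds x hρ)] with y hy
  exact canPush_of_ball hρ hb hy

theorem mem_iff_of_forall_notMem_eq {V : Set ℂ} {φ : ℂ ≃ₜ ℂ} (h : ∀ z, z ∉ V → φ z = z) (z : ℂ) :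
    φ z ∈ V ↔ z ∈ V := by
  by_cases hz : z ∈ V
  · refine iff_of_true ?_ hz
    by_contra hφ
    have := φ.injective (h _ hφ)
    rw [this] at hφ
    exact hφ hz
  · rw [h z hz]

/-- `g` is a product of functions without zeros off `Z₁` and off `Z₂` respectively. -/
def Splits {X : Type*} [TopologicalSpace X] (g : X → ℂ) (Z₁ Z₂ : Set X) : Prop :=
  ∃ g₁ g₂ : X → ℂ, ContinuousOn g₁ Z₁ᶜ ∧ ContinuousOn g₂ Z₂ᶜ ∧ (∀ x, x ∉ Z₁ → g₁ x ≠ 0) ∧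
    (∀ x, x ∉ Z₂ → g₂ x ≠ 0) ∧ ∀ x, x ∉ Z₁ → x ∉ Z₂ → g x = g₁ x * g₂ x

open Classical in
theorem exists_interpolated_factor {X : Type*} [TopologicalSpace X]
    {T₁ T₂ U₁ U₂ Z₁ Z₂ Z₁' Z₂' : Set X} (hT₁ : IsClosed T₁) (hT₂ : IsClosed T₂)
    (hU₁ : IsOpen U₁) (hU₂ : IsOpen U₂) (hTU₁ : T₁ ⊆ U₁) (hTU₂ : T₂ ⊆ U₂) (hU : Disjoint U₁ U₂)
    (hZ₁ : Z₁ ⊆ T₁) (hZ₂ : Z₂ ⊆ T₂) (hZ₂' : Z₂' ⊆ T₂)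
    (hc₁ : IsClosed Z₁') (hc₂ : IsClosed Z₂')
    {g g' a₁ a₂ l w : X → ℂ} (ha₁ : ContinuousOn a₁ Z₁ᶜ) (ha₂ : ContinuousOn a₂ Z₂ᶜ)
    (h₁ : ∀ x, x ∉ Z₁ → a₁ x ≠ 0) (h₂ : ∀ x, x ∉ Z₂ → a₂ x ≠ 0)
    (hg : ∀ x, x ∉ Z₁ → x ∉ Z₂ → g x = a₁ x * a₂ x)
    (hg' : ContinuousOn g' (Z₁' ∪ Z₂')ᶜ) (hg0 : ∀ x, x ∉ Z₁' ∪ Z₂' → g' x ≠ 0)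
    (hl : ContinuousOn l (T₁ ∪ T₂)ᶜ)
    (hle : ∀ x, x ∉ T₁ ∪ T₂ → Complex.exp (l x) = g' x / g x)
    (hw : Continuous w) (hw₁ : ∀ x ∈ U₁, w x = 1) (hw₂ : ∀ x ∈ U₂, w x = 0) :
    ContinuousOn (fun x => if x ∈ U₂ then a₁ x else if x ∈ U₁ then g' x / a₂ x else
        a₁ x * Complex.exp (w x * l x)) Z₁'ᶜ ∧
      ∀ x, x ∉ Z₁' → (if x ∈ U₂ then a₁ x else if x ∈ U₁ then g' x / a₂ x else
        a₁ x * Complex.exp (w x * l x)) ≠ 0 := by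
  have d12 : ∀ x ∈ U₁, x ∉ U₂ := fun x h h' => (Set.disjoint_left.1 hU) h h'
  have d21 : ∀ x ∈ U₂, x ∉ U₁ := fun x h h' => (Set.disjoint_left.1 hU) h' h
  have hdiv : ∀ x, x ∉ T₁ → x ∉ T₂ → g' x / a₂ x = a₁ x * Complex.exp (l x) := by
    intro x hx1 hx2
    have e1 := h₁ x (fun h => hx1 (hZ₁ h))
    have e2 := h₂ x (fun h => hx2 (hZ₂ h))
    rw [hle x (by simp [hx1, hx2]), hg x (fun h => hx1 (hZ₁ h)) (fun h => hx2 (hZ₂ h))]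
    field_simp
  constructor
  · intro x hx
    apply ContinuousAt.continuousWithinAt
    by_cases hx2 : x ∈ U₂
    · have hx1 : x ∉ Z₁ᶜᶜ := fun h => d21 x hx2 (hTU₁ (hZ₁ (not_not.1 h)))
      have hsub : U₂ ⊆ Z₁ᶜ := fun y hy h => d21 y hy (hTU₁ (hZ₁ h))
      refine ((ha₁.mono hsub).continuousAt (hU₂.mem_nhds hx2)).congr ?_
      filter_upwards [hU₂.mem_nhds hx2] with y hy
      simp [hy]
    by_cases hx1 : x ∈ U₁
    · have hsub : U₁ ⊆ Z₂ᶜ := fun y hy h => d12 y hy (hTU₂ (hZ₂ h))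
      have hx' : (Z₁' ∪ Z₂')ᶜ ∈ 𝓝 x := (hc₁.union hc₂).isOpen_compl.mem_nhds (by
        rintro (h | h)
        · exact hx h
        · exact hx2 (hTU₂ (hZ₂' h)))
      refine ((hg'.continuousAt hx').div ((ha₂.mono hsub).continuousAt (hU₁.mem_nhds hx1))
        (h₂ x (hsub hx1))).congr ?_
      filter_upwards [hU₁.mem_nhds hx1] with y hy
      simp [hy, d12 y hy]
    · have hx' : (T₁ ∪ T₂)ᶜ ∈ 𝓝 x := (hT₁.union hT₂).isOpen_compl.mem_nhds (by
        rintro (h | h)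
        · exact hx1 (hTU₁ h)
        · exact hx2 (hTU₂ h))
      have hsub : (T₁ ∪ T₂)ᶜ ⊆ Z₁ᶜ := fun y hy h => hy (Or.inl (hZ₁ h))
      have : ContinuousAt (fun x => a₁ x * Complex.exp (w x * l x)) x :=
        ((ha₁.mono hsub).continuousAt hx').mul
          (Complex.continuous_exp.continuousAt.comp (hw.continuousAt.mul (hl.continuousAt hx')))
      refine this.congr ?_
      filter_upwards [hx'] with y hy
      have hy1 : y ∉ T₁ := fun h => hy (Or.inl h)
      have hy2 : y ∉ T₂ := fun h => hy (Or.inr h)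
      by_cases hyU2 : y ∈ U₂
      · simp [hyU2, hw₂ y hyU2]
      by_cases hyU1 : y ∈ U₁
      · simp [hyU1, hyU2, hw₁ y hyU1, hdiv y hy1 hy2]
      · simp [hyU1, hyU2]
  · intro x hx
    by_cases hx2 : x ∈ U₂
    · simp only [hx2, if_true]
      exact h₁ x (fun h => d21 x hx2 (hTU₁ (hZ₁ h)))
    by_cases hx1 : x ∈ U₁
    · simp only [hx1, hx2, if_true, if_false]
      refine div_ne_zero (hg0 x ?_) (h₂ x fun h => hx2 (hTU₂ (hZ₂ h)))
      rintro (h | h)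
      · exact hx h
      · exact hx2 (hTU₂ (hZ₂' h))
    · simp only [hx1, hx2, if_false]
      exact mul_ne_zero (h₁ x fun h => hx1 (hTU₁ (hZ₁ h))) (Complex.exp_ne_zero _)

theorem Splits.of_log {X : Type*} [TopologicalSpace X] [NormalSpace X]
    {T₁ T₂ Z₁ Z₂ Z₁' Z₂' : Set X} (hT₁ : IsClosed T₁) (hT₂ : IsClosed T₂) (hT : Disjoint T₁ T₂)
    (hZ₁ : Z₁ ⊆ T₁) (hZ₂ : Z₂ ⊆ T₂) (hZ₁' : Z₁' ⊆ T₁) (hZ₂' : Z₂' ⊆ T₂)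
    (hc₁ : IsClosed Z₁') (hc₂ : IsClosed Z₂') {g g' l : X → ℂ}
    (hg' : ContinuousOn g' (Z₁' ∪ Z₂')ᶜ) (hg0 : ∀ x, x ∉ Z₁' ∪ Z₂' → g' x ≠ 0)
    (hl : ContinuousOn l (T₁ ∪ T₂)ᶜ)
    (hle : ∀ x, x ∉ T₁ ∪ T₂ → Complex.exp (l x) = g' x / g x)
    (h : Splits g Z₁ Z₂) : Splits g' Z₁' Z₂' := by
  classical
  obtain ⟨a₁, a₂, ha₁, ha₂, h₁, h₂, hg⟩ := h
  obtain ⟨u, hu₁, hu₂, hu⟩ := exists_continuous_zero_one_of_isClosed hT₂ hT₁ hT.symm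
  set U₁ : Set X := {x | 2 / 3 < u x} with hU₁
  set U₂ : Set X := {x | u x < 1 / 3} with hU₂
  have oU₁ : IsOpen U₁ := isOpen_lt continuous_const u.continuous
  have oU₂ : IsOpen U₂ := isOpen_lt u.continuous continuous_const
  have hTU₁ : T₁ ⊆ U₁ := fun x hx => by
    have : u x = 1 := hu₂ hx
    simp only [hU₁, mem_ofPred_eq, this]; norm_num
  have hTU₂ : T₂ ⊆ U₂ := fun x hx => by
    have : u x = 0 := hu₁ hx
    simp only [hU₂, mem_ofPred_eq, this]; norm_num
  have hdU : Disjoint U₁ U₂ := Set.disjoint_left.2 fun x hx hx' => by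
    simp only [hU₁, hU₂, mem_ofPred_eq] at hx hx'; linarith
  let v : X → ℝ := fun x => max 0 (min 1 (3 * u x - 1))
  have hv : Continuous v := by fun_prop
  have hv₁ : ∀ x ∈ U₁, v x = 1 := fun x hx => by
    simp only [hU₁, mem_ofPred_eq] at hx
    simp only [v]; rw [min_eq_left (by linarith)]; norm_num
  have hv₂ : ∀ x ∈ U₂, v x = 0 := fun x hx => by
    simp only [hU₂, mem_ofPred_eq] at hx
    simp only [v]; exact max_eq_left ((min_le_right _ _).trans (by linarith))
  have A := exists_interpolated_factor hT₁ hT₂ oU₁ oU₂ hTU₁ hTU₂ hdU hZ₁ hZ₂ hZ₂' hc₁ hc₂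
    ha₁ ha₂ h₁ h₂ hg hg' hg0 hl hle (w := fun x => (v x : ℂ)) (by fun_prop)
    (fun x hx => by simp [hv₁ x hx]) (fun x hx => by simp [hv₂ x hx])
  have B := exists_interpolated_factor hT₂ hT₁ oU₂ oU₁ hTU₂ hTU₁ hdU.symm hZ₂ hZ₁ hZ₁' hc₂ hc₁
    ha₂ ha₁ h₂ h₁ (g := g) (fun x h h' => by rw [hg x h' h, mul_comm])
    (by rwa [union_comm]) (by rwa [union_comm]) (by rwa [union_comm]) (by rwa [union_comm])
    (w := fun x => 1 - (v x : ℂ)) (by fun_prop)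
    (fun x hx => by simp [hv₂ x hx]) (fun x hx => by simp [hv₁ x hx])
  refine ⟨_, _, A.1, B.1, A.2, B.2, ?_⟩
  intro x hx1 hx2
  have d12 : ∀ x ∈ U₁, x ∉ U₂ := fun x h h' => (Set.disjoint_left.1 hdU) h h'
  by_cases hxU2 : x ∈ U₂
  · have hxU1 : x ∉ U₁ := fun h => d12 x h hxU2
    have := h₁ x (fun h => hxU1 (hTU₁ (hZ₁ h)))
    simp only [hxU1, hxU2, if_true, if_false]
    field_simp
  by_cases hxU1 : x ∈ U₁
  · have := h₂ x (fun h => hxU2 (hTU₂ (hZ₂ h)))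
    simp only [hxU1, hxU2, if_true, if_false]
    field_simp
  · simp only [hxU1, hxU2, if_false]
    have t1 : x ∉ T₁ := fun h => hxU1 (hTU₁ h)
    have t2 : x ∉ T₂ := fun h => hxU2 (hTU₂ h)
    have e1 := h₁ x (fun h => t1 (hZ₁ h))
    have e2 := h₂ x (fun h => t2 (hZ₂ h))
    have e3 : Complex.exp (v x * l x) * Complex.exp ((1 - v x) * l x) = g' x / g x := by
      rw [← Complex.exp_add, ← hle x (by simp [t1, t2])]
      congr 1; ring
    rw [hg x (fun h => t1 (hZ₁ h)) (fun h => t2 (hZ₂ h))] at e3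
    rw [mul_mul_mul_comm, e3]
    field_simp

theorem Splits.of_homotopy {X : Type*} [TopologicalSpace X] [CompactSpace X] [T2Space X]
    {Z₁ Z₂ : Set (ℝ × X)} (hZ₁ : IsClosed Z₁) (hZ₂ : IsClosed Z₂) (hZ : Disjoint Z₁ Z₂)
    {G : ℝ × X → ℂ} (hG : ContinuousOn G (Z₁ ∪ Z₂)ᶜ) (hG0 : ∀ p, p ∉ Z₁ ∪ Z₂ → G p ≠ 0)
    {s t : ℝ} (h : Splits (fun x => G (s, x)) {x | (s, x) ∈ Z₁} {x | (s, x) ∈ Z₂}) :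
    Splits (fun x => G (t, x)) {x | (t, x) ∈ Z₁} {x | (t, x) ∈ Z₂} := by
  let P : ℝ → ℝ → Prop := fun s t =>
    Splits (fun x => G (s, x)) {x | (s, x) ∈ Z₁} {x | (s, x) ∈ Z₂} →
      Splits (fun x => G (t, x)) {x | (t, x) ∈ Z₁} {x | (t, x) ∈ Z₂}
  suffices P s t from this h
  have hcl : ∀ {Z : Set (ℝ × X)}, IsClosed Z → ∀ t, IsClosed {x | (t, x) ∈ Z} := fun hZ t =>
    hZ.preimage (by fun_prop)
  refine PreconnectedSpace.induction₂' P ?_ ⟨fun a b c hab hbc h => hbc (hab h)⟩ s t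
  intro r
  obtain ⟨O₁, O₂, ho₁, ho₂, hs₁, hs₂, hO⟩ :
      ∃ O₁ O₂ : Set X, IsOpen O₁ ∧ IsOpen O₂ ∧ {x | (r, x) ∈ Z₁} ⊆ O₁ ∧ {x | (r, x) ∈ Z₂} ⊆ O₂ ∧
        Disjoint (closure O₁) (closure O₂) := by
    have hd : Disjoint {x | (r, x) ∈ Z₁} {x | (r, x) ∈ Z₂} :=
      Set.disjoint_left.2 fun x h h' => (Set.disjoint_left.1 hZ) h h'
    obtain ⟨O₁, O₂, h1, h2, h3, h4, h5⟩ := NormalSpace.normal _ _ (hcl hZ₁ r) (hcl hZ₂ r) hd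
    obtain ⟨V₁, v1, v2, v3⟩ := normal_exists_closure_subset (hcl hZ₁ r) h1 h3
    obtain ⟨V₂, w1, w2, w3⟩ := normal_exists_closure_subset (hcl hZ₂ r) h2 h4
    exact ⟨V₁, V₂, v1, w1, v2, w2, h5.mono v3 w3⟩
  have near : ∀ {Z : Set (ℝ × X)} {O : Set X}, IsClosed Z → IsOpen O → {x | (r, x) ∈ Z} ⊆ O →
      ∀ᶠ t in 𝓝 r, {x | (t, x) ∈ Z} ⊆ O := by
    intro Z O hZ hO hs
    have hc : IsClosed (Prod.fst '' (Z ∩ {p | p.2 ∉ O})) :=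
      isClosedMap_fst_of_compactSpace _ (hZ.inter (hO.isClosed_compl.preimage continuous_snd))
    have : r ∉ Prod.fst '' (Z ∩ {p | p.2 ∉ O}) := by
      rintro ⟨⟨a, b⟩, ⟨h1, h2⟩, rfl⟩
      exact h2 (hs h1)
    filter_upwards [hc.isOpen_compl.mem_nhds this] with t ht x hx
    by_contra hxO
    exact ht ⟨(t, x), ⟨hx, hxO⟩, rfl⟩
  obtain ⟨ε, hε, hball⟩ := Metric.eventually_nhds_iff_ball.1
    ((near hZ₁ ho₁ hs₁).and (near hZ₂ ho₂ hs₂))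
  have key : ∀ a ∈ Metric.ball r ε, ∀ b ∈ Metric.ball r ε, P a b := by
    intro a ha b hb
    have hseg : ∀ q ∈ Icc (0 : ℝ) 1, a + q * (b - a) ∈ Metric.ball r ε := fun q hq =>
      (convex_ball r ε).add_smul_sub_mem ha hb hq
    have hout : ∀ q ∈ Icc (0 : ℝ) 1, ∀ x ∈ (closure O₁ ∪ closure O₂)ᶜ,
        (a + q * (b - a), x) ∈ (Z₁ ∪ Z₂)ᶜ := by
      rintro q hq x hx (h | h)
      · exact hx (Or.inl (subset_closure ((hball _ (hseg q hq)).1 h)))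
      · exact hx (Or.inr (subset_closure ((hball _ (hseg q hq)).2 h)))
    have ha' : ∀ x ∈ (closure O₁ ∪ closure O₂)ᶜ, (a, x) ∈ (Z₁ ∪ Z₂)ᶜ := fun x hx => by
      simpa using hout 0 (by simp) x hx
    obtain ⟨L, hL, hLe, -⟩ := exists_log_of_homotopy (S := (closure O₁ ∪ closure O₂)ᶜ)
      (m := fun p => G (a + p.1 * (b - a), p.2) / G (a, p.2)) (l := fun _ => 0)
      (ContinuousOn.div (hG.comp (by fun_prop) (fun p hp => hout _ hp.1 _ hp.2))
        (hG.comp (by fun_prop) (fun p hp => ha' _ hp.2)) (fun p hp => hG0 _ (ha' _ hp.2)))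
      (fun p hp => div_ne_zero (hG0 _ (hout _ hp.1 _ hp.2)) (hG0 _ (ha' _ hp.2)))
      continuousOn_const (fun x hx => by simp [div_self (hG0 _ (ha' _ hx))])
    refine Splits.of_log (l := fun x => L (1, x)) isClosed_closure isClosed_closure hO
      ((hball a ha).1.trans subset_closure) ((hball a ha).2.trans subset_closure)
      ((hball b hb).1.trans subset_closure) ((hball b hb).2.trans subset_closure)
      (hcl hZ₁ b) (hcl hZ₂ b) ?_ ?_ ?_ ?_
    · exact hG.comp (by fun_prop) (fun x hx => hx)
    · exact fun x hx => hG0 _ hx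
    · exact hL.comp (by fun_prop) (fun x hx => ⟨by simp, hx⟩)
    · intro x hx
      rw [hLe (1, x) ⟨by simp, hx⟩]
      simp
  filter_upwards [Metric.ball_mem_nhds r hε] with y hy
  exact ⟨key _ (Metric.mem_ball_self hε) _ hy, key _ hy _ (Metric.mem_ball_self hε)⟩

/-- A contraction of a contractible space to a given point, with time extended to the real line. -/
theorem exists_contraction {X : Type*} [TopologicalSpace X] [ContractibleSpace X] (x₀ : X) :
    ∃ c : ℝ × X → X, Continuous c ∧ (∀ x, c (0, x) = x₀) ∧ ∀ x, c (1, x) = x := by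
  obtain ⟨x₁, h₁⟩ := id_nullhomotopic X
  have h₂ : (ContinuousMap.const X x₁).Homotopic (ContinuousMap.const X x₀) :=
    ContinuousMap.homotopic_const_iff.2 (PathConnectedSpace.joined x₁ x₀)
  obtain ⟨h⟩ := h₁.trans h₂
  refine ⟨fun p => h.symm (projIcc 0 1 zero_le_one p.1, p.2), ?_, ?_, ?_⟩
  · exact h.symm.continuous.comp (by fun_prop)
  · intro x; simp
  · intro x; simp

theorem splits_of_contractible {X : Type*} [TopologicalSpace X] [CompactSpace X] [T2Space X]
    [ContractibleSpace X] {Z₁ Z₂ : Set X} (hZ₁ : IsClosed Z₁) (hZ₂ : IsClosed Z₂)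
    (hZ : Disjoint Z₁ Z₂) {g : X → ℂ} (hg : ContinuousOn g (Z₁ ∪ Z₂)ᶜ)
    (hg0 : ∀ x, x ∉ Z₁ ∪ Z₂ → g x ≠ 0) : Splits g Z₁ Z₂ := by
  obtain ⟨x₀⟩ : Nonempty X := inferInstance
  obtain ⟨c, hc, h0, h1⟩ := exists_contraction x₀
  have := Splits.of_homotopy (G := fun p => g (c p)) (hZ₁.preimage hc) (hZ₂.preimage hc)
    (hZ.preimage c) (hg.comp hc.continuousOn fun p hp => hp) (fun p hp => hg0 _ hp)
    (s := 0) (t := 1) ?_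
  · simpa [h1] using this
  · by_cases hx : x₀ ∈ Z₁ ∪ Z₂
    · refine ⟨fun _ => 1, fun _ => 1, continuousOn_const, continuousOn_const, by simp, by simp, ?_⟩
      intro x hx1 hx2
      simp only [mem_ofPred_eq, mem_preimage, h0] at hx1 hx2
      exact absurd hx (by simp [hx1, hx2])
    · exact ⟨fun _ => g x₀, fun _ => 1, continuousOn_const, continuousOn_const,
        fun _ _ => hg0 _ hx, by simp, by simp [h0]⟩

theorem exists_log_of_contractibleSpace {X : Type*} [TopologicalSpace X] [ContractibleSpace X]
    {g : X → ℂ} (hg : Continuous g) (hg0 : ∀ x, g x ≠ 0) :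
    ∃ L : X → ℂ, Continuous L ∧ ∀ x, Complex.exp (L x) = g x := by
  obtain ⟨x₀⟩ : Nonempty X := inferInstance
  obtain ⟨c, hc, h0, h1⟩ := exists_contraction x₀
  obtain ⟨L, hL, hLe⟩ := exists_log_of_contraction (S := univ) hg.continuousOn (fun x _ => hg0 x)
    (mem_univ x₀) hc.continuousOn (fun _ _ => mem_univ _) (fun x _ => h0 x) (fun x _ => h1 x)
  exact ⟨L, continuousOn_univ.1 hL, fun x => hLe x (mem_univ x)⟩

/-- A logarithm on a horizontal slice extends over a product with contractible fibres. -/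
theorem exists_log_prod {W Y : Type*} [TopologicalSpace W] [TopologicalSpace Y]
    [ContractibleSpace Y] {A : Set W} {g : W × Y → ℂ} (hg : ContinuousOn g (A ×ˢ univ))
    (hg0 : ∀ p ∈ A ×ˢ univ, g p ≠ 0) {a : Y} {l : W → ℂ} (hl : ContinuousOn l A)
    (hle : ∀ w ∈ A, Complex.exp (l w) = g (w, a)) :
    ∃ L : W × Y → ℂ, ContinuousOn L (A ×ˢ univ) ∧ ∀ p ∈ A ×ˢ univ, Complex.exp (L p) = g p := by
  obtain ⟨c, hc, h0, h1⟩ := exists_contraction a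
  obtain ⟨L, hL, hLe, -⟩ := exists_log_of_homotopy (S := A ×ˢ (univ : Set Y))
    (m := fun p => g (p.2.1, c (p.1, p.2.2))) (l := fun p => l p.1)
    (hg.comp (Continuous.continuousOn (by fun_prop)) (fun p hp => ⟨hp.2.1, mem_univ _⟩))
    (fun p hp => hg0 _ ⟨hp.2.1, mem_univ _⟩)
    (hl.comp continuousOn_fst (fun p hp => hp.1))
    (fun p hp => by simp only [h0]; exact hle _ hp.1)
  refine ⟨fun p => L (1, p), hL.comp (by fun_prop) (fun x hx => ⟨by simp, hx⟩), fun p hp => ?_⟩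
  rw [hLe (1, p) ⟨by simp, hp⟩]
  simp [h1]

theorem no_two_cycle {Y : Type*} [TopologicalSpace Y] [CompactSpace Y] [T2Space Y]
    [ContractibleSpace Y] {κ : Y → ℂ} (hκ : Continuous κ) {h : ℂ → Y} {D D' E Ω O A : Set ℂ}
    (hh : ContinuousOn h D') (hκh : ∀ z ∈ D', κ (h z) = z) (hκD : ∀ y, κ y ∈ D)
    {F : ℂ ≃ₜ ℂ} (hF : HasSecantLog F) (hFD : F '' D = E) (hΩ : IsOpen Ω) (hO : IsOpen O)
    (hΩO : Disjoint Ω O) (hcov : D ∩ E ⊆ Ω ∪ O) (hfix : ∀ z ∈ Ω, F z ≠ z) (hA : IsPreconnected A)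
    (hAΩ : A ⊆ Ω) (hAD : A ⊆ D') (hAE : A ⊆ F '' D') {x y : ℂ} (hx : x ∈ A) (hy : y ∈ A)
    (hxy : F x = y) (hyx : F y = x) : False := by
  obtain ⟨ℓ, hℓ⟩ := hF
  let g : Y × Y → ℂ := fun p => F (κ p.1) - κ p.2
  have hg : Continuous g := by fun_prop
  let Z₁ : Set (Y × Y) := {p | g p = 0} ∩ {p | κ p.2 ∉ O}
  let Z₂ : Set (Y × Y) := {p | g p = 0} ∩ {p | κ p.2 ∉ Ω}
  have hZ : IsClosed {p | g p = 0} := isClosed_eq hg continuous_const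
  have hZ₁ : IsClosed Z₁ := hZ.inter (hO.isClosed_compl.preimage (hκ.comp continuous_snd))
  have hZ₂ : IsClosed Z₂ := hZ.inter (hΩ.isClosed_compl.preimage (hκ.comp continuous_snd))
  have hzero : ∀ p, g p = 0 → κ p.2 ∈ Ω ∪ O := fun p hp => hcov ⟨hκD _, by
    rw [← hFD]
    exact ⟨κ p.1, hκD _, sub_eq_zero.1 hp⟩⟩
  have hZ₁' : ∀ p ∈ Z₁, κ p.2 ∈ Ω := fun p hp => (hzero p hp.1).resolve_right hp.2
  have hdis : Disjoint Z₁ Z₂ := Set.disjoint_left.2 fun p h h' => h'.2 (hZ₁' p h)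
  have hunion : ∀ p, g p ≠ 0 → p ∉ Z₁ ∧ p ∉ Z₂ := fun p hp => ⟨fun h => hp h.1, fun h => hp h.1⟩
  obtain ⟨g₁, g₂, hg₁, hg₂, hn₁, hn₂, hgg⟩ := splits_of_contractible hZ₁ hZ₂ hdis hg.continuousOn
    (fun p hp h0 => by
      rcases hzero p h0 with h | h
      · exact hp (Or.inl ⟨h0, fun h' => Set.disjoint_left.1 hΩO h h'⟩)
      · exact hp (Or.inr ⟨h0, fun h' => Set.disjoint_left.1 hΩO h' h⟩))
  have hdiag : ∀ y, (y, y) ∉ Z₁ := fun y hy => hfix _ (hZ₁' _ hy) (sub_eq_zero.1 hy.1)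
  obtain ⟨L₁, hL₁, hLe₁⟩ := exists_log_of_contractibleSpace (g := fun y => g₁ (y, y))
    (hg₁.comp_continuous (by fun_prop) hdiag) (fun y => hn₁ _ (hdiag y))
  let B : Set ℂ := F.symm '' A
  have hBD : B ⊆ D' := by
    rintro _ ⟨w, hw, rfl⟩
    obtain ⟨v, hv, rfl⟩ := hAE hw
    simpa using hv
  have hFB : ∀ z ∈ B, F z ∈ A := by
    rintro _ ⟨w, hw, rfl⟩
    simpa using hw
  have hBp : IsPreconnected B := hA.image _ F.symm.continuous.continuousOn
  let A₁ : Set Y := h '' B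
  let A₂ : Set Y := h '' A
  have hout₁ : ∀ p ∈ A₁ ×ˢ (univ : Set Y), p ∉ Z₂ := by
    rintro ⟨_, y'⟩ ⟨⟨z, hz, rfl⟩, -⟩ hp
    have : F (κ (h z)) = κ y' := sub_eq_zero.1 hp.1
    rw [hκh z (hBD hz)] at this
    exact hp.2 (this ▸ hAΩ (hFB z hz))
  have hout₂ : ∀ p ∈ (univ : Set Y) ×ˢ A₂, p ∉ Z₂ := by
    rintro ⟨y', _⟩ ⟨-, ⟨z, hz, rfl⟩⟩ hp
    refine hp.2 ?_
    simp only [hκh z (hAD hz)]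
    exact hAΩ hz
  have hxB : x ∈ B := ⟨y, hy, by rw [← hxy]; simp⟩
  have hyB : y ∈ B := ⟨x, hx, by rw [← hyx]; simp⟩
  have hx₁ : h x ∈ A₁ := ⟨x, hxB, rfl⟩
  have hx₂ : h x ∈ A₂ := ⟨x, hx, rfl⟩
  obtain ⟨l₁, hl₁, hle₁⟩ := exists_log_of_contractibleSpace (g := fun y => g₂ (y, h x))
    (hg₂.comp_continuous (by fun_prop) fun y => hout₂ (y, h x) ⟨mem_univ _, hx₂⟩)
    (fun y => hn₂ _ (hout₂ (y, h x) ⟨mem_univ _, hx₂⟩))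
  obtain ⟨l₂, hl₂, hle₂⟩ := exists_log_of_contractibleSpace (g := fun y => g₂ (h x, y))
    (hg₂.comp_continuous (by fun_prop) fun y => hout₁ (h x, y) ⟨hx₁, mem_univ _⟩)
    (fun y => hn₂ _ (hout₁ (h x, y) ⟨hx₁, mem_univ _⟩))
  obtain ⟨μ₁, hμ₁, hμe₁⟩ := exists_log_prod (A := A₁) (g := g₂) (hg₂.mono hout₁)
    (fun p hp => hn₂ p (hout₁ p hp)) hl₁.continuousOn (fun w _ => hle₁ w)
  have hswap : MapsTo Prod.swap (A₂ ×ˢ (univ : Set Y)) Z₂ᶜ := fun p hp =>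
    hout₂ _ ⟨mem_univ _, hp.1⟩
  obtain ⟨μ₂, hμ₂, hμe₂⟩ := exists_log_prod (A := A₂) (g := fun p => g₂ p.swap)
    (hg₂.comp continuous_swap.continuousOn hswap)
    (fun p hp => hn₂ _ (hswap hp)) hl₂.continuousOn (fun w _ => hle₂ w)
  set k : ℂ := μ₁ (h x, h x) - μ₂ (h x, h x) with hk
  have hAc : IsPreconnected (A₁ ×ˢ A₂) :=
    (hBp.image _ (hh.mono hBD)).prod (hA.image _ (hh.mono hAD))
  have hμ : ∀ p ∈ A₁ ×ˢ A₂, Complex.exp (μ₁ p - μ₂ p.swap) = 1 := by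
    intro p hp
    have e1 := hμe₁ p ⟨hp.1, mem_univ _⟩
    have e2 := hμe₂ p.swap ⟨hp.2, mem_univ _⟩
    rw [Prod.swap_swap] at e2
    rw [Complex.exp_sub, e1, e2]
    exact div_self (hn₂ _ (hout₁ p ⟨hp.1, mem_univ _⟩))
  have hμc : ∀ p ∈ A₁ ×ˢ A₂, μ₁ p - μ₂ p.swap = k := by
    intro p hp
    refine eq_of_exp_eq_one hAc (f := fun p => μ₁ p - μ₂ p.swap) (ContinuousOn.sub ?_ ?_) hμ hp
      (y := (h x, h x)) ⟨hx₁, hx₂⟩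
    · exact hμ₁.mono (fun p hp => ⟨hp.1, mem_univ _⟩)
    · exact hμ₂.comp continuous_swap.continuousOn (fun p hp => ⟨hp.2, mem_univ _⟩)
  have hk1 : Complex.exp k = 1 := hμ (h x, h x) ⟨hx₁, hx₂⟩
  let lam₁ : ℂ → ℂ := fun z => L₁ (h z) + μ₂ (h z, h z) + k
  let lam₂ : ℂ → ℂ := fun z => L₁ (h z) + μ₁ (h z, h z)
  have hagree : ∀ z ∈ A, z ∈ B → lam₁ z = lam₂ z := by
    intro z hz hz'
    have := hμc (h z, h z) ⟨⟨z, hz', rfl⟩, ⟨z, hz, rfl⟩⟩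
    simp only [Prod.swap_prod_mk] at this
    simp only [lam₁, lam₂, ← this]
    ring
  have hgz : ∀ z ∈ D', F z ≠ z → g₁ (h z, h z) * g₂ (h z, h z) = F z - z := by
    intro z hz hne
    have : g (h z, h z) = F z - z := by simp only [g, hκh z hz]
    have h0 : g (h z, h z) ≠ 0 := by rw [this]; exact sub_ne_zero.2 hne
    rw [← this, hgg _ (hunion _ h0).1 (hunion _ h0).2]
  have he₁ : ∀ z ∈ A, Complex.exp (lam₁ z) = F z - z := by
    intro z hz
    have e2 := hμe₂ (h z, h z) ⟨⟨z, hz, rfl⟩, mem_univ _⟩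
    simp only [Prod.swap_prod_mk] at e2
    rw [← hgz z (hAD hz) (hfix z (hAΩ hz)), Complex.exp_add, Complex.exp_add, hk1, hLe₁, e2,
      mul_one]
  have hBne : ∀ z ∈ B, F z ≠ z := fun z hz hzz =>
    hfix _ (hAΩ (hFB z hz)) (congrArg F hzz)
  have he₂ : ∀ z ∈ B, Complex.exp (lam₂ z) = F z - z := by
    intro z hz
    have e1 := hμe₁ (h z, h z) ⟨⟨z, hz, rfl⟩, mem_univ _⟩
    rw [← hgz z (hBD hz) (hBne z hz), Complex.exp_add, hLe₁, e1]
  have hsB : ∀ w ∈ A, F.symm w ∈ B := fun w hw => ⟨w, hw, rfl⟩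
  have hne : ∀ w ∈ A, w ≠ F.symm w := fun w hw hww => hfix w (hAΩ hw) (by
    rw [hww]; simpa using hww)
  have hlam₁ : ContinuousOn lam₁ A := by
    have hA' : ContinuousOn h A := hh.mono hAD
    exact ((hL₁.comp_continuousOn hA').add (hμ₂.comp (hA'.prodMk hA')
      (fun z hz => ⟨⟨z, hz, rfl⟩, mem_univ _⟩))).add continuousOn_const
  have hlam₂ : ContinuousOn lam₂ B := by
    have hB' : ContinuousOn h B := hh.mono hBD
    exact (hL₁.comp_continuousOn hB').add (hμ₁.comp (hB'.prodMk hB')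
      (fun z hz => ⟨⟨z, hz, rfl⟩, mem_univ _⟩))
  have hconst := eq_of_exp_eq_one hA
    (f := fun w => lam₁ w - lam₂ (F.symm w) - ℓ (w, F.symm w))
    ((hlam₁.sub (hlam₂.comp F.symm.continuous.continuousOn hsB)).sub
      (hℓ.1.comp (by fun_prop) hne)) (fun w hw => by
        have h1 := hne w hw
        have h2 := hfix w (hAΩ hw)
        rw [Complex.exp_sub, Complex.exp_sub, he₁ w hw, he₂ _ (hsB w hw), hℓ.2 _ _ h1,
          F.apply_symm_apply]
        have h3 := sub_ne_zero.2 h1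
        have h4 := sub_ne_zero.2 h2
        field_simp) hx hy
  have hsx : F.symm x = y := by rw [← hyx]; simp
  have hsy : F.symm y = x := by rw [← hxy]; simp
  have hxy' : x ≠ y := fun h' => hfix x (hAΩ hx) (by rw [hxy, h'])
  simp only [hsx, hsy] at hconst
  rw [hℓ.symmetric hxy', ← hagree x hx hxB, ← hagree y hy hyB] at hconst
  have h2 : (2 : ℂ) * (lam₁ x - lam₁ y) = 0 := by linear_combination hconst
  have h3 := sub_eq_zero.1 ((mul_eq_zero.1 h2).resolve_left two_ne_zero)
  have h4 := he₁ x hx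
  rw [h3, he₁ y hy, hxy, hyx] at h4
  have h5 : (2 : ℂ) * (x - y) = 0 := by linear_combination h4
  exact hxy' (sub_eq_zero.1 ((mul_eq_zero.1 h5).resolve_left two_ne_zero))

theorem exists_isPreconnected_nhds_avoiding {R : Set (ℂ × ℂ)} (hR : IsClosed R) {Q O : Set ℂ}
    (hQ : IsCompact Q) (hQc : IsPreconnected Q) (hne : Q.Nonempty) (hO : IsOpen O) (hQO : Q ⊆ O)
    (h : ∀ z ∈ Q, ∀ w ∈ Q, (z, w) ∉ R) :
    ∃ V, IsOpen V ∧ IsPreconnected V ∧ Q ⊆ V ∧ V ⊆ O ∧ ∀ z ∈ V, ∀ w ∈ V, (z, w) ∉ R := by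
  obtain ⟨u, v, hu, hv, hQu, hQv, huv⟩ := generalized_tube_lemma hQ hQ hR.isOpen_compl
    (fun p hp => h p.1 hp.1 p.2 hp.2)
  obtain ⟨q, hq⟩ := hne
  have hsub : Q ⊆ u ∩ v ∩ O := fun z hz => ⟨⟨hQu hz, hQv hz⟩, hQO hz⟩
  refine ⟨connectedComponentIn (u ∩ v ∩ O) q, ((hu.inter hv).inter hO).connectedComponentIn,
    isPreconnected_connectedComponentIn, hQc.subset_connectedComponentIn hq hsub, ?_, ?_⟩
  · exact (connectedComponentIn_subset _ _).trans inter_subset_right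
  · intro z hz w hw
    exact huv ⟨(connectedComponentIn_subset _ _ hz).1.1, (connectedComponentIn_subset _ _ hw).1.2⟩

/-- Nested neighbourhoods `D i`, `E i` of the domain and of the image together with nested
neighbourhoods `Ω i` of a component of their intersection, such that homeomorphisms respecting them
and without fixed points in `Ω j` have no points of period two in `Ω (j + 1)`. -/
structure Tower (D E Ω : ℕ → Set ℂ) : Prop where
  isOpen_D : ∀ i, IsOpen (D i)
  isOpen_E : ∀ i, IsOpen (E i)
  isOpen_Ω : ∀ i, IsOpen (Ω i)
  antitone_D : Antitone D
  antitone_E : Antitone E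
  antitone_Ω : Antitone Ω
  isPathConnected : ∀ i, IsPathConnected (Ω i)
  subset_D : ∀ i, Ω i ⊆ D i
  subset_E : ∀ i, Ω i ⊆ E i
  closure_subset : ∀ i, closure (Ω (i + 1)) ⊆ Ω i
  no_two_cycle : ∀ (F : ℂ ≃ₜ ℂ) (j : ℕ), HasSecantLog F → (∀ i ≤ j + 1, F '' D i = E i) →
    (∀ z ∈ Ω j, F z ≠ z) → ∀ x ∈ Ω (j + 1), ∀ y ∈ Ω (j + 1), F x = y → F y = x → False

/-- Homeomorphisms carrying `D i` to `E i` for `i ≤ k` without fixed points in `Ω j`. -/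
structure Admissible (D E Ω : ℕ → Set ℂ) (k j : ℕ) (F : ℂ ≃ₜ ℂ) : Prop where
  hasSecantLog : HasSecantLog F
  image_eq : ∀ i ≤ k, F '' D i = E i
  ne : ∀ z ∈ Ω j, F z ≠ z

/-- There are no orbits of period `m` deep inside a tower. -/
def NoCycle (m : ℕ) : Prop :=
  ∀ D E Ω : ℕ → Set ℂ, Tower D E Ω → ∀ (j : ℕ) (F : ℂ ≃ₜ ℂ),
    Admissible D E Ω (j + (2 * m - 3)) j F → ∀ x, (∀ i < m, F^[i] x ∈ Ω (j + (2 * m - 3))) →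
      F^[m] x ≠ x

section Tower

variable {D E Ω : ℕ → Set ℂ} {k j : ℕ} {F : ℂ ≃ₜ ℂ}

theorem symm_image_eq {F : ℂ ≃ₜ ℂ} {A B : Set ℂ} (h : F '' A = B) : F.symm '' B = A := by
  rw [← h, ← image_comp]
  simp

theorem Tower.symm (T : Tower D E Ω) : Tower E D Ω where
  isOpen_D := T.isOpen_E
  isOpen_E := T.isOpen_D
  isOpen_Ω := T.isOpen_Ω
  antitone_D := T.antitone_E
  antitone_E := T.antitone_D
  antitone_Ω := T.antitone_Ω
  isPathConnected := T.isPathConnected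
  subset_D := T.subset_E
  subset_E := T.subset_D
  closure_subset := T.closure_subset
  no_two_cycle := fun F j hF hDE hne x hx y hy hxy hyx =>
    T.no_two_cycle F.symm j hF.symm (fun i hi => symm_image_eq (hDE i hi))
      (fun z hz h => hne z hz (by rw [F.symm_apply_eq] at h; exact h.symm)) y hy x hx
      (by rw [F.symm_apply_eq, hxy]) (by rw [F.symm_apply_eq, hyx])

theorem Admissible.symm (h : Admissible D E Ω k j F) : Admissible E D Ω k j F.symm where
  hasSecantLog := h.hasSecantLog.symm
  image_eq := fun i hi => symm_image_eq (h.image_eq i hi)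
  ne := fun z hz hz' => h.ne z hz (by rw [F.symm_apply_eq] at hz'; exact hz'.symm)

theorem Admissible.mono (h : Admissible D E Ω k j F) (T : Tower D E Ω) {k' j' : ℕ} (hk : k' ≤ k)
    (hj : j ≤ j') : Admissible D E Ω k' j' F where
  hasSecantLog := h.hasSecantLog
  image_eq := fun i hi => h.image_eq i (hi.trans hk)
  ne := fun z hz => h.ne z (T.antitone_Ω hj hz)

theorem image_eq_of_forall_notMem_eq {V A : Set ℂ} {φ : ℂ ≃ₜ ℂ} (h : ∀ z, z ∉ V → φ z = z)
    (hVA : V ⊆ A) : φ '' A = A := by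
  have hA : ∀ z, z ∉ A → φ z = z := fun z hz => h z fun hz' => hz (hVA hz')
  refine Subset.antisymm (image_subset_iff.2 fun z hz => (mem_iff_of_forall_notMem_eq hA z).2 hz)
    fun z hz => ⟨φ.symm z, ?_, φ.apply_symm_apply z⟩
  rw [← mem_iff_of_forall_notMem_eq hA]
  simpa using hz

/-- Composition with a homeomorphism supported in a set that is free for `F`. -/
theorem Admissible.trans_of_free (h : Admissible D E Ω k j F) (T : Tower D E Ω) {V : Set ℂ}
    (hVE : V ⊆ E k) (hV : ∀ z ∈ V, z ∈ Ω j → F z ∉ V) {φ : ℂ ≃ₜ ℂ} (hφ : HasSecantLog φ)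
    (hφV : ∀ z, z ∉ V → φ z = z) : Admissible D E Ω k j (F.trans φ) where
  hasSecantLog := h.hasSecantLog.trans hφ
  image_eq := fun i hi => by
    have hc : ⇑(F.trans φ) = φ ∘ F := rfl
    rw [hc, image_comp, h.image_eq i hi]
    exact image_eq_of_forall_notMem_eq hφV (hVE.trans (T.antitone_E hi))
  ne := fun z hz hz' => by
    rw [Homeomorph.trans_apply] at hz'
    by_cases hF : F z ∈ V
    · refine hV z ?_ hz hF
      rw [← hz']
      exact (mem_iff_of_forall_notMem_eq hφV _).2 hF
    · exact h.ne z hz (by rwa [hφV _ hF] at hz')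

theorem iterate_trans_eq {F φ : ℂ ≃ₜ ℂ} {V : Set ℂ} (hφV : ∀ z, z ∉ V → φ z = z) {z : ℂ} {m : ℕ}
    (h : ∀ r, 1 ≤ r → r ≤ m → F^[r] z ∉ V) : (F.trans φ)^[m] z = F^[m] z := by
  induction m with
  | zero => rfl
  | succ m ih =>
    rw [Function.iterate_succ_apply', ih (fun r h1 h2 => h r h1 (by omega)),
      Homeomorph.trans_apply, ← Function.iterate_succ_apply' (⇑F), hφV]
    exact h _ (by omega) le_rfl

/-- An orbit segment with both ends in a free disc is closed up to a cycle. -/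
theorem Admissible.not_return {n : ℕ} (IH : ∀ m, 1 ≤ m → m < n → NoCycle m)
    (h : Admissible D E Ω k j F) (T : Tower D E Ω) {V : Set ℂ} (hVo : IsOpen V)
    (hVc : IsPreconnected V) (hVE : V ⊆ E k) (hV : ∀ z ∈ V, z ∈ Ω j → F z ∉ V) {z : ℂ} {m : ℕ}
    (hm : 1 ≤ m) (hmn : m < n) (hk : j + (2 * m - 3) ≤ k) (hz : z ∈ V)
    (hΩ : ∀ r < m, F^[r] z ∈ Ω (j + (2 * m - 3))) : F^[m] z ∉ V := by
  classical
  intro hmV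
  have hex : ∃ r, 1 ≤ r ∧ F^[r] z ∈ V := ⟨m, hm, hmV⟩
  obtain ⟨h1, h2⟩ := Nat.find_spec hex
  have hmin : ∀ r, 1 ≤ r → r < Nat.find hex → F^[r] z ∉ V := fun r hr hr' hrV =>
    Nat.find_min hex hr' ⟨hr, hrV⟩
  have hle : Nat.find hex ≤ m := Nat.find_min' hex ⟨hm, hmV⟩
  set q := Nat.find hex
  obtain ⟨φ, hφ, hφq, hφV⟩ := canPush_of_isPreconnected hVo hVc h2 hz
  have hG := h.trans_of_free T hVE hV hφ hφV
  have heq : ∀ r < q, (F.trans φ)^[r] z = F^[r] z := fun r hr =>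
    iterate_trans_eq hφV fun r' h' h'' => hmin r' h' (by omega)
  refine IH q h1 (by omega) D E Ω T j (F.trans φ) (hG.mono T (by omega) le_rfl) z ?_ ?_
  · intro i hi
    rw [heq i hi]
    exact T.antitone_Ω (by omega) (hΩ i (by omega))
  · obtain ⟨p, hp⟩ : ∃ p, q = p + 1 := ⟨q - 1, by omega⟩
    rw [hp, Function.iterate_succ_apply', heq p (by omega), Homeomorph.trans_apply,
      ← Function.iterate_succ_apply' (⇑F), Nat.succ_eq_add_one, ← hp, hφq]

theorem Admissible.iterate_ne {n : ℕ} (IH : ∀ m, 1 ≤ m → m < n → NoCycle m)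
    (h : Admissible D E Ω k j F) (T : Tower D E Ω) (hk : j + (2 * (n - 1) - 3) ≤ k) {x : ℂ}
    (hΩ : ∀ i < n, F^[i] x ∈ Ω k) {i l : ℕ} (hil : i < l) (hl : l < n) :
    F^[i] x ≠ F^[l] x := by
  intro heq
  have hx : F^[l - i] x = x := by
    apply F.injective.iterate i
    rw [← Function.iterate_add_apply, heq]
    congr 2
    omega
  refine IH (l - i) (by omega) (by omega) D E Ω T j F (h.mono T (by omega) le_rfl) x ?_ hx
  intro r hr
  exact T.antitone_Ω (by omega) (hΩ r (by omega))

theorem isClosed_setOf_apply_eq (F : ℂ ≃ₜ ℂ) : IsClosed {p : ℂ × ℂ | F p.1 = p.2} :=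
  isClosed_eq (F.continuous.comp continuous_fst) continuous_snd

/-- There is no arc from a point of a cycle of length `n` to its image which is free away from
its end. -/
theorem Admissible.false_of_free_arc {n : ℕ} (hn : 3 ≤ n) (IH : ∀ m, 1 ≤ m → m < n → NoCycle m)
    (h : Admissible D E Ω k j F) (T : Tower D E Ω) (hk : k = j + (2 * (n - 1) - 3)) {x : ℂ}
    (hΩ : ∀ i < n, F^[i] x ∈ Ω k) (hx : F^[n] x = x) {α : ℝ → ℂ} (hα : Continuous α) {t s : ℝ}
    (hts : t < s) (hαt : α t = x) (hαs : α s = F x) (hαE : ∀ a ∈ Icc t s, α a ∈ E k)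
    (hfree : ∀ a ∈ Ico t s, ∀ b ∈ Ico t s, α a ∈ closure (Ω j) → F (α a) ≠ α b) : False := by
  set R : Set (ℂ × ℂ) := {p | p.1 ∈ closure (Ω j)} ∩ {p | F p.1 = p.2} with hRdef
  have hR : IsClosed R :=
    (isClosed_closure.preimage continuous_fst).inter (isClosed_setOf_apply_eq F)
  have hnbhd : ∀ a ∈ Ico t s, ∀ O, IsOpen O → α '' Icc t a ⊆ O →
      ∃ V, IsOpen V ∧ IsPreconnected V ∧ α '' Icc t a ⊆ V ∧ V ⊆ O ∧
        ∀ z ∈ V, z ∈ Ω j → F z ∉ V := by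
    intro a ha O hO hQO
    obtain ⟨V, hVo, hVc, hQV, hVO, hV⟩ := exists_isPreconnected_nhds_avoiding hR
      (isCompact_Icc.image hα) (isPreconnected_Icc.image α hα.continuousOn)
      ⟨α t, mem_image_of_mem α (left_mem_Icc.2 ha.1)⟩ hO hQO (by
        rintro _ ⟨b, hb, rfl⟩ _ ⟨c, hc, rfl⟩ ⟨hcl, hbc⟩
        exact hfree b ⟨hb.1, hb.2.trans_lt ha.2⟩ c ⟨hc.1, hc.2.trans_lt ha.2⟩ hcl hbc)
    exact ⟨V, hVo, hVc, hQV, hVO, fun z hz hzΩ hFz => hV z hz _ hFz ⟨subset_closure hzΩ, rfl⟩⟩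
  have hdisj : ∀ i, 2 ≤ i → i < n → F^[i] x ∉ α '' Icc t s := by
    rintro i hi hin ⟨a, ha, hai⟩
    rcases ha.2.eq_or_lt with rfl | has
    · exact h.iterate_ne IH T hk.ge hΩ (show 1 < i by omega) hin (by simpa [← hαs] using hai)
    · obtain ⟨V, hVo, hVc, hQV, hVE, hV⟩ := hnbhd a ⟨ha.1, has⟩ (E k) (T.isOpen_E k) (by
        rintro _ ⟨b, hb, rfl⟩
        exact hαE b ⟨hb.1, hb.2.trans has.le⟩)
      refine h.not_return IH T hVo hVc hVE hV (show 1 ≤ i by omega) hin (by omega)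
        (hQV ⟨t, left_mem_Icc.2 ha.1, hαt⟩) (fun r hr => ?_) ?_
      · exact T.antitone_Ω (by omega) (hΩ r (by omega))
      · rw [← hai]
        exact hQV ⟨a, right_mem_Icc.2 ha.1, rfl⟩
  set z := F^[n - 1] x with hz
  have hFz : F z = x := by
    rw [hz, ← Function.iterate_succ_apply' (⇑F), show (n - 1).succ = n by omega, hx]
  have hzx : x ≠ z := h.iterate_ne IH T hk.ge hΩ (show 0 < n - 1 by omega) (by omega)
  have hzΩ : z ∈ Ω k := hΩ _ (by omega)
  have hQcl : IsClosed (α '' Icc t s) := (isCompact_Icc.image hα).isClosed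
  obtain ⟨W, hWo, -, hzW, hWO, hW⟩ := exists_isPreconnected_nhds_avoiding
    (isClosed_setOf_apply_eq F) isCompact_singleton isPreconnected_singleton
    (singleton_nonempty z) ((T.isOpen_Ω k).inter hQcl.isOpen_compl)
    (singleton_subset_iff.2 ⟨hzΩ, hdisj _ (by omega) (by omega)⟩) (by
      rintro _ rfl _ rfl hzz
      exact hzx (hFz.symm.trans hzz))
  obtain ⟨r, hr, hrW⟩ := Metric.nhds_basis_closedBall.mem_iff.1
    (hWo.mem_nhds (hzW (mem_singleton z)))
  have hev : ∀ᶠ s' in 𝓝 s, (∀ i ∈ Finset.range (n - 1), F^[i] (α s') ∈ Ω k) ∧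
      (∀ i ∈ Finset.Ico 1 (n - 1), F^[i] (α s') ∉ α '' Icc t s) ∧
      F^[n - 2] (α s') ∈ Metric.ball z r := by
    have hcont : ∀ i, Continuous fun s' => F^[i] (α s') := fun i =>
      (F.continuous.iterate i).comp hα
    have hval : ∀ i, F^[i] (α s) = F^[i + 1] x := fun i => by
      rw [hαs, Function.iterate_succ_apply]
    refine Eventually.and ?_ (Eventually.and ?_ ?_)
    · rw [Filter.eventually_all_finset]
      intro i hi
      rw [Finset.mem_range] at hi
      refine (hcont i).continuousAt.eventually_mem ((T.isOpen_Ω k).mem_nhds ?_)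
      rw [hval]
      exact hΩ _ (by omega)
    · rw [Filter.eventually_all_finset]
      intro i hi
      rw [Finset.mem_Ico] at hi
      refine (hcont i).continuousAt.eventually_mem (hQcl.isOpen_compl.mem_nhds ?_)
      rw [hval]
      exact hdisj _ (by omega) (by omega)
    · refine (hcont _).continuousAt.eventually_mem (Metric.isOpen_ball.mem_nhds ?_)
      rw [hval, show n - 2 + 1 = n - 1 by omega]
      exact Metric.mem_ball_self hr
  obtain ⟨s', ⟨hs1, hs2, hs3⟩, hs'⟩ :=
    ((hev.filter_mono nhdsWithin_le_nhds).and (Ioo_mem_nhdsLT hts)).exists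
  set y := α s' with hy
  have hQ' : α '' Icc t s' ⊆ α '' Icc t s := image_mono (Icc_subset_Icc_right hs'.2.le)
  have hfin : IsClosed ((fun i => F^[i] y) '' Ico 1 (n - 1)) :=
    ((finite_Ico _ _).image _).isClosed
  obtain ⟨V, hVo, hVc, hQV, hVO, hV⟩ := hnbhd s' ⟨hs'.1.le, hs'.2⟩
    (E k ∩ (Metric.closedBall z r)ᶜ ∩ ((fun i => F^[i] y) '' Ico 1 (n - 1))ᶜ)
    (((T.isOpen_E k).inter Metric.isClosed_closedBall.isOpen_compl).inter hfin.isOpen_compl) (by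
      intro w hw
      refine ⟨⟨?_, fun hwr => (hWO (hrW hwr)).2 (hQ' hw)⟩, ?_⟩
      · obtain ⟨a, ha, rfl⟩ := hQ' hw
        exact hαE a ha
      · rintro ⟨i, hi, rfl⟩
        exact hs2 i (Finset.mem_Ico.2 hi) (hQ' hw))
  obtain ⟨φ, hφ, hφx, hφV⟩ := canPush_of_isPreconnected hVo hVc
    (hQV ⟨t, left_mem_Icc.2 hs'.1.le, hαt⟩) (hQV ⟨s', right_mem_Icc.2 hs'.1.le, rfl⟩)
  have hG := h.trans_of_free T (fun w hw => (hVO hw).1.1) hV hφ hφV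
  have hGz : F.trans φ z = y := by rw [Homeomorph.trans_apply, hFz, hφx]
  have hGy : ∀ i < n - 1, (F.trans φ)^[i] y = F^[i] y := fun i hi =>
    iterate_trans_eq hφV fun r h1 h2 hrV => (hVO hrV).2 ⟨r, ⟨h1, by omega⟩, rfl⟩
  have hball : Metric.ball z r ⊆ W := Metric.ball_subset_closedBall.trans hrW
  refine hG.not_return IH T Metric.isOpen_ball (convex_ball z r).isPreconnected
    (fun w hw => T.subset_E k (hWO (hball hw)).1) ?_ (show 1 ≤ n - 1 by omega) (by omega)
    hk.ge (Metric.mem_ball_self hr) ?_ ?_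
  · intro u hu _ hGu
    rw [Homeomorph.trans_apply] at hGu
    by_cases hFu : F u ∈ V
    · exact (hVO ((mem_iff_of_forall_notMem_eq hφV _).2 hFu)).1.2
        (Metric.ball_subset_closedBall hGu)
    · rw [hφV _ hFu] at hGu
      exact hW u (hball hu) _ (hball hGu) rfl
  · intro i hi
    rw [← hk]
    rcases i with _ | i
    · exact hzΩ
    · rw [Function.iterate_succ_apply, hGz, hGy i (by omega)]
      exact hs1 i (Finset.mem_range.2 (by omega))
  · rw [show n - 1 = n - 2 + 1 by omega, Function.iterate_succ_apply, hGz, hGy _ (by omega)]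
    exact hs3

/-- An arc issuing from a point of a cycle does not first fail to be free by having the image of
one of its points as its end. -/
theorem Admissible.false_of_arc_to_image {n : ℕ} (hn : 3 ≤ n)
    (IH : ∀ m, 1 ≤ m → m < n → NoCycle m)
    (h : Admissible D E Ω k j F) (T : Tower D E Ω) (hk : k = j + (2 * n - 3)) {x : ℂ}
    (hΩ : ∀ i < n, F^[i] x ∈ Ω k) (hx : F^[n] x = x) {γ : ℝ → ℂ} (hγ : Continuous γ) {t s : ℝ}
    (ht : 0 ≤ t) (hts : t < s) (hγ0 : γ 0 = x) (hγΩ : ∀ a ∈ Icc 0 s, γ a ∈ Ω k)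
    (hγs : F (γ t) = γ s) (hfree : ∀ a ∈ Ico 0 s, ∀ b ∈ Ico 0 s, F (γ a) ≠ γ b) : False := by
  have hnbhd : ∀ b ∈ Ico 0 s, ∃ V, IsOpen V ∧ IsPreconnected V ∧ γ '' Icc 0 b ⊆ V ∧ V ⊆ E k ∧
        ∀ z ∈ V, z ∈ Ω j → F z ∉ V := by
    intro b hb
    obtain ⟨V, hVo, hVc, hQV, hVO, hV⟩ := exists_isPreconnected_nhds_avoiding
      (isClosed_setOf_apply_eq F) (isCompact_Icc.image hγ)
      (isPreconnected_Icc.image γ hγ.continuousOn)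
      ⟨γ 0, mem_image_of_mem γ (left_mem_Icc.2 hb.1)⟩ (T.isOpen_E k) (by
        rintro _ ⟨a, ha, rfl⟩
        exact T.subset_E k (hγΩ a ⟨ha.1, ha.2.trans hb.2.le⟩)) (by
        rintro _ ⟨a, ha, rfl⟩ _ ⟨c, hc, rfl⟩ hac
        exact hfree a ⟨ha.1, ha.2.trans_lt hb.2⟩ c ⟨hc.1, hc.2.trans_lt hb.2⟩ hac)
    exact ⟨V, hVo, hVc, hQV, hVO, fun z hz _ hFz => hV z hz _ hFz rfl⟩
  have hFF : ∀ a ∈ Ico 0 s, ∀ b ∈ Ico 0 s, F (γ a) ∈ Ω (j + 1) → F (F (γ a)) ≠ γ b := by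
    intro a ha b hb hFa hab
    obtain ⟨V, hVo, hVc, hQV, hVE, hV⟩ := hnbhd (max a b) ⟨le_max_of_le_left ha.1, max_lt ha.2 hb.2⟩
    refine h.not_return (m := 2) IH T hVo hVc hVE hV (by omega) (by omega) (by omega)
      (hQV ⟨a, ⟨ha.1, le_max_left _ _⟩, rfl⟩) ?_ ?_
    · intro r hr
      interval_cases r
      · exact T.antitone_Ω (by omega) (hγΩ a ⟨ha.1, ha.2.le⟩)
      · exact hFa
    · change F (F (γ a)) ∈ V
      rw [hab]
      exact hQV ⟨b, ⟨hb.1, le_max_right _ _⟩, rfl⟩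
  have hFγ : ∀ a ∈ Icc 0 s, ∀ b ∈ Ico 0 s, F (γ a) ≠ γ b := by
    intro a ha b hb
    rcases ha.2.eq_or_lt with rfl | has
    · rw [← hγs]
      refine hFF t ⟨ht, hts⟩ b hb ?_
      rw [hγs]
      exact T.antitone_Ω (by omega) (hγΩ a ha)
    · exact hfree a ⟨ha.1, has⟩ b hb
  have hFFt : ∀ a ∈ Icc 0 t, ∀ b ∈ Icc 0 s, F (γ a) ∈ Ω (j + 1) → F (F (γ a)) ≠ γ b := by
    intro a ha b hb hFa hab
    rcases hb.2.eq_or_lt with rfl | hbs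
    · rw [← hγs] at hab
      exact hfree a ⟨ha.1, ha.2.trans_lt hts⟩ t ⟨ht, hts⟩ (F.injective hab)
    · exact hFF a ⟨ha.1, ha.2.trans_lt hts⟩ b ⟨hb.1, hbs⟩ hFa hab
  have hcl : closure (Ω (j + 2)) ⊆ Ω (j + 1) := T.closure_subset (j + 1)
  have hQ : IsCompact (γ '' Icc 0 s) := isCompact_Icc.image hγ
  obtain ⟨U, hUo, hUc, hQU, hUO, hU⟩ := exists_isPreconnected_nhds_avoiding
    ((isClosed_setOf_apply_eq F).union (((isClosed_closure (s := Ω (j + 2))).preimage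
      (F.continuous.comp continuous_fst)).inter
      (isClosed_eq ((F.continuous.comp F.continuous).comp continuous_fst) continuous_snd)))
    ((isCompact_Icc (a := (0 : ℝ)) (b := t)).image hγ)
    (isPreconnected_Icc.image γ hγ.continuousOn)
    ⟨γ 0, mem_image_of_mem γ (left_mem_Icc.2 ht)⟩
    (((T.isOpen_Ω k).inter (hQ.image F.continuous).isClosed.isOpen_compl).inter
      (((isClosed_closure (s := Ω (j + 2))).preimage F.continuous).inter
        (hQ.isClosed.preimage (F.continuous.comp F.continuous))).isOpen_compl) (by
      rintro _ ⟨a, ha, rfl⟩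
      refine ⟨⟨hγΩ a ⟨ha.1, ha.2.trans hts.le⟩, ?_⟩, ?_⟩
      · rintro ⟨_, ⟨b, hb, rfl⟩, hba⟩
        exact hFγ b hb a ⟨ha.1, ha.2.trans_lt hts⟩ hba
      · rintro ⟨h1, b, hb, hba⟩
        exact hFFt a ha b hb (hcl h1) hba.symm) (by
      rintro _ ⟨a, ha, rfl⟩ _ ⟨b, hb, rfl⟩ (hab | ⟨h1, hab⟩)
      · exact hfree a ⟨ha.1, ha.2.trans_lt hts⟩ b ⟨hb.1, hb.2.trans_lt hts⟩ hab
      · exact hFFt a ha b ⟨hb.1, hb.2.trans hts.le⟩ (hcl h1) hab)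
  have hU1 : ∀ u ∈ U, F u ∉ U := fun u hu hFu => hU u hu _ hFu (Or.inl rfl)
  have hU2 : ∀ a ∈ Icc 0 s, F (γ a) ∉ U := fun a ha hFa =>
    (hUO hFa).1.2 ⟨_, ⟨a, ha, rfl⟩, rfl⟩
  have hU3 : ∀ u ∈ U, F u ∈ closure (Ω (j + 2)) → F (F u) ∉ U := fun u hu h1 h2 =>
    hU u hu _ h2 (Or.inr ⟨h1, rfl⟩)
  have hU4 : ∀ u ∈ U, F u ∈ closure (Ω (j + 2)) → ∀ a ∈ Icc 0 s, F (F u) ≠ γ a :=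
    fun u hu h1 a ha h2 => (hUO hu).2 ⟨h1, a, ha, h2.symm⟩
  have hxU : x ∈ U := hQU ⟨0, left_mem_Icc.2 ht, hγ0⟩
  have hpU : γ t ∈ U := hQU ⟨t, right_mem_Icc.2 ht, rfl⟩
  obtain ⟨ψ, -, hψp, hψU⟩ := canPush_of_isPreconnected hUo hUc hpU hxU
  have hψ : ∀ z, ψ z ∈ U ↔ z ∈ U := mem_iff_of_forall_notMem_eq hψU
  have hcase : ∀ a, (F.symm (γ a) ∉ U ∧ ψ (F (ψ (F.symm (γ a)))) = ψ (γ a)) ∨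
      (F.symm (γ a) ∈ U ∧ ψ (F (ψ (F.symm (γ a)))) = F (ψ (F.symm (γ a)))) := by
    intro a
    by_cases ha : F.symm (γ a) ∈ U
    · exact Or.inr ⟨ha, hψU _ (hU1 _ ((hψ _).2 ha))⟩
    · refine Or.inl ⟨ha, ?_⟩
      rw [hψU _ ha, F.apply_symm_apply]
  have hDψ : ψ '' D k = D k :=
    image_eq_of_forall_notMem_eq hψU fun u hu => T.subset_D k (hUO hu).1.1
  have hEψ : ψ '' E k = E k :=
    image_eq_of_forall_notMem_eq hψU fun u hu => T.subset_E k (hUO hu).1.1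
  have hFk : F '' D k = E k := h.image_eq k le_rfl
  refine (h.mono T le_rfl (show j ≤ j + 2 by omega)).false_of_free_arc hn IH T (by omega) hΩ hx
    (α := fun a => ψ (F (ψ (F.symm (γ a))))) (by fun_prop) hts ?_ ?_ ?_ ?_
  · rcases hcase t with ⟨-, h1⟩ | ⟨h1, -⟩
    · exact h1.trans hψp
    · exact absurd hpU (by simpa using hU1 _ h1)
  · have h1 : F.symm (γ s) = γ t := by rw [F.symm_apply_eq, hγs]
    simp only [h1, hψp]
    exact hψU _ (hU1 x hxU)
  · intro a ha
    have h1 : F.symm (γ a) ∈ D k := by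
      rw [← symm_image_eq hFk]
      exact mem_image_of_mem _ (T.subset_E k (hγΩ a ⟨ht.trans ha.1, ha.2⟩))
    have h2 : ψ (F.symm (γ a)) ∈ D k := hDψ ▸ mem_image_of_mem ψ h1
    have h3 : F (ψ (F.symm (γ a))) ∈ E k := hFk ▸ mem_image_of_mem F h2
    exact hEψ ▸ mem_image_of_mem ψ h3
  · intro a ha b hb hac hab
    have ha' : a ∈ Ico 0 s := ⟨ht.trans ha.1, ha.2⟩
    have hb' : b ∈ Ico 0 s := ⟨ht.trans hb.1, hb.2⟩
    rcases hcase a with ⟨ha1, ha2⟩ | ⟨ha1, ha2⟩ <;> rcases hcase b with ⟨hb1, hb2⟩ | ⟨hb1, hb2⟩ <;>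
      rw [ha2] at hac <;> rw [ha2, hb2] at hab
    · by_cases haU : γ a ∈ U <;> by_cases hbU : γ b ∈ U
      · exact hU1 _ ((hψ _).2 haU) (hab ▸ (hψ _).2 hbU)
      · rw [hψU _ hbU] at hab
        refine hb1 ?_
        rw [← hab, F.symm_apply_apply]
        exact (hψ _).2 haU
      · rw [hψU _ haU] at hab
        refine hU2 a ⟨ha'.1, ha'.2.le⟩ ?_
        rw [hab]
        exact (hψ _).2 hbU
      · rw [hψU _ haU, hψU _ hbU] at hab
        exact hfree a ha' b hb' hab
    · refine hfree a ha' b hb' ?_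
      rw [ψ.injective (F.injective hab), F.apply_symm_apply]
    · have huU := (hψ _).2 ha1
      by_cases hbU : γ b ∈ U
      · refine hU3 _ huU hac ?_
        rw [hab]
        exact (hψ _).2 hbU
      · rw [hψU _ hbU] at hab
        exact hU4 _ huU hac b ⟨hb'.1, hb'.2.le⟩ hab
    · refine hU1 _ ((hψ _).2 ha1) ?_
      rw [F.injective hab]
      exact (hψ _).2 hb1

theorem noCycle_of_forall_lt {n : ℕ} (hn : 3 ≤ n) (IH : ∀ m, 1 ≤ m → m < n → NoCycle m) :
    NoCycle n := by
  intro D E Ω T j F h x hΩ hx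
  set k := j + (2 * n - 3) with hk
  have hj : Ω k ⊆ Ω j := T.antitone_Ω (by omega)
  obtain ⟨p, hp⟩ := (T.isPathConnected k).joinedIn x (hΩ 0 (by omega)) (F x) (hΩ 1 (by omega))
  set γ : ℝ → ℂ := ⇑p.extend
  have hγ : Continuous γ := p.extend.continuous
  have hγΩ : ∀ a, γ a ∈ Ω k := fun a => hp (projIcc 0 1 zero_le_one a)
  have hγ0 : γ 0 = x := p.extend_zero
  have hγ1 : γ 1 = F x := p.extend_one
  set Z : Set (ℝ × ℝ) := (Icc 0 1 ×ˢ Icc 0 1) ∩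
    {q | q.2 ≤ q.1 ∧ (F (γ q.2) = γ q.1 ∨ F (γ q.1) = γ q.2)} with hZ
  have hZc : IsCompact Z := by
    refine (isCompact_Icc.prod isCompact_Icc).inter_right ?_
    refine (isClosed_le continuous_snd continuous_fst).inter (IsClosed.union ?_ ?_)
    · exact isClosed_eq (by fun_prop) (by fun_prop)
    · exact isClosed_eq (by fun_prop) (by fun_prop)
  obtain ⟨s, ⟨⟨⟨s', t⟩, ⟨⟨hs, ht⟩, hts, hst⟩, rfl⟩, hmin⟩⟩ :=
    (hZc.image continuous_fst).exists_isLeast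
      ⟨1, (1, 0), ⟨⟨by simp, by simp⟩, by simp, Or.inl (by simp [hγ0, hγ1])⟩, rfl⟩
  simp only at hs ht hts hst hmin
  have hfree : ∀ a ∈ Ico 0 s', ∀ b ∈ Ico 0 s', F (γ a) ≠ γ b := by
    intro a ha b hb hab
    rcases le_total a b with hle | hle
    · exact hb.2.not_ge (hmin ⟨(b, a), ⟨⟨⟨hb.1, hb.2.le.trans hs.2⟩,
        ⟨ha.1, ha.2.le.trans hs.2⟩⟩, hle, Or.inl hab⟩, rfl⟩)
    · exact ha.2.not_ge (hmin ⟨(a, b), ⟨⟨⟨ha.1, ha.2.le.trans hs.2⟩,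
        ⟨hb.1, hb.2.le.trans hs.2⟩⟩, hle, Or.inr hab⟩, rfl⟩)
  have hlt : t < s' := by
    refine hts.lt_of_ne ?_
    rintro rfl
    exact h.ne _ (hj (hγΩ t)) (by simpa using hst)
  rcases hst with hst | hst
  · exact h.false_of_arc_to_image hn IH T hk hΩ hx hγ ht.1 hlt hγ0 (fun a _ => hγΩ a) hst hfree
  · have hinv : ∀ i ≤ n, F.symm^[i] x = F^[n - i] x := by
      intro i hi
      have hl : Function.LeftInverse F.symm^[i] F^[i] :=
        Function.LeftInverse.iterate F.symm_apply_apply i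
      conv_lhs => rw [← hx, show n = i + (n - i) by omega, Function.iterate_add_apply]
      exact hl _
    refine h.symm.false_of_arc_to_image hn IH T.symm hk ?_ ?_ hγ ht.1 hlt hγ0 (fun a _ => hγΩ a)
      (by rw [F.symm_apply_eq, hst]) ?_
    · intro i hi
      rcases i with _ | i
      · exact hΩ 0 (by omega)
      · rw [hinv _ hi.le]
        exact hΩ _ (by omega)
    · rw [hinv n le_rfl, Nat.sub_self]
      rfl
    · intro a ha b hb hab
      rw [F.symm_apply_eq] at hab
      exact hfree b hb a ha hab.symm

theorem noCycle (m : ℕ) (hm : 1 ≤ m) : NoCycle m := by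
  induction m using Nat.strong_induction_on with
  | _ m ih =>
    rcases (by omega : m = 1 ∨ m = 2 ∨ 3 ≤ m) with rfl | rfl | hm3
    · intro D E Ω T j F h x hΩ hx
      exact h.ne x (hΩ 0 one_pos) hx
    · intro D E Ω T j F h x hΩ hx
      exact T.no_two_cycle F j h.hasSecantLog h.image_eq h.ne x (hΩ 0 two_pos) (F x)
        (hΩ 1 one_lt_two) rfl hx
    · exact noCycle_of_forall_lt hm3 fun m' h1 h2 => ih m' h2 h1

end Tower

/-- Homeomorphisms of the plane without fixed points in an open and closed part `Ω` of the
intersection of `U` with its image have no two-cycles in connected subsets of `Ω` lying in the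
intersection of `U'` with its image. -/
def ExcludesTwoCycles (U U' : Set ℂ) : Prop :=
  ∀ (F : ℂ ≃ₜ ℂ) (Ω O A : Set ℂ), HasSecantLog F → IsOpen Ω → IsOpen O → Disjoint Ω O →
    U ∩ F '' U ⊆ Ω ∪ O → (∀ z ∈ Ω, F z ≠ z) → IsPreconnected A → A ⊆ Ω → A ⊆ U' → A ⊆ F '' U' →
      ∀ x ∈ A, ∀ y ∈ A, F x = y → F y = x → False

section Retract

variable {B : Type*} [TopologicalSpace B] [CompactSpace B] [T2Space B] [ContractibleSpace B]
  {κ : B → ℂ} {ρ : ℂ → B}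

theorem exists_excludesTwoCycles (hκ : Continuous κ) (hρ : Continuous ρ)
    (hκρ : ∀ z ∈ range κ, κ (ρ z) = z) {U : Set ℂ} (hU : IsOpen U) (hκU : range κ ⊆ U) :
    ∃ U', IsOpen U' ∧ range κ ⊆ U' ∧ closure U' ⊆ U ∧ ExcludesTwoCycles U U' := by
  obtain ⟨ε, hε, hεU⟩ := (isCompact_range hκ).exists_cthickening_subset_open hU hκU
  have hmem : ∀ b e, ‖e‖ ≤ ε → κ b + e ∈ U := fun b e he =>
    hεU (Metric.mem_cthickening_of_dist_le _ (κ b) ε _ (mem_range_self b) (by simpa using he))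
  have hc : Continuous fun z => ‖z - κ (ρ z)‖ := by fun_prop
  refine ⟨{z | ‖z - κ (ρ z)‖ < ε}, isOpen_lt hc continuous_const, ?_, ?_, ?_⟩
  · intro z hz
    simpa [hκρ z hz] using hε
  · refine (closure_lt_subset_le hc continuous_const).trans fun z hz => ?_
    simpa using hmem (ρ z) (z - κ (ρ z)) hz
  · intro F Ω O A hF hΩ hO hΩO hcov hfix hA hAΩ hAU hAF x hx y hy hxy hyx
    have : ContractibleSpace (Metric.closedBall (0 : ℂ) ε) :=
      (convex_closedBall 0 ε).contractibleSpace ⟨0, Metric.mem_closedBall_self hε.le⟩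
    have hp : ∀ e : ℂ, ∃ q : Metric.closedBall (0 : ℂ) ε, ‖e‖ < ε → (q : ℂ) = e := fun e => by
      by_cases he : ‖e‖ < ε
      · exact ⟨⟨e, by simpa using he.le⟩, fun _ => rfl⟩
      · exact ⟨⟨0, Metric.mem_closedBall_self hε.le⟩, fun h => absurd h he⟩
    choose p hp using hp
    have hpc : ContinuousOn (fun z => p (z - κ (ρ z))) {z | ‖z - κ (ρ z)‖ < ε} := by
      rw [Topology.IsInducing.subtypeVal.continuousOn_iff]
      refine ContinuousOn.congr (f := fun z => z - κ (ρ z)) (by fun_prop) fun z hz => hp _ hz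
    refine no_two_cycle (Y := B × Metric.closedBall (0 : ℂ) ε)
      (κ := fun q => κ q.1 + q.2) (h := fun z => (ρ z, p (z - κ (ρ z)))) (by fun_prop)
      (D := U) (D' := {z | ‖z - κ (ρ z)‖ < ε}) (hρ.continuousOn.prodMk hpc) ?_
      (fun q => hmem q.1 q.2 (mem_closedBall_zero_iff.1 q.2.2)) hF rfl hΩ hO hΩO hcov hfix hA
      hAΩ hAU hAF hx hy hxy hyx
    intro z hz
    simp [hp _ hz]

theorem exists_seq_excludesTwoCycles (hκ : Continuous κ) (hρ : Continuous ρ)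
    (hκρ : ∀ z ∈ range κ, κ (ρ z) = z) {U : Set ℂ} (hU : IsOpen U) (hκU : range κ ⊆ U) :
    ∃ V : ℕ → Set ℂ, V 0 = U ∧ ∀ i, IsOpen (V i) ∧ range κ ⊆ V i ∧ closure (V (i + 1)) ⊆ V i ∧
      ExcludesTwoCycles (V i) (V (i + 1)) := by
  have hstep : ∀ W : {W : Set ℂ // IsOpen W ∧ range κ ⊆ W},
      ∃ W' : {W : Set ℂ // IsOpen W ∧ range κ ⊆ W}, closure W'.1 ⊆ W.1 ∧
        ExcludesTwoCycles W.1 W'.1 := by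
    rintro ⟨W, hW, hκW⟩
    obtain ⟨W', h1, h2, h3, h4⟩ := exists_excludesTwoCycles hκ hρ hκρ hW hκW
    exact ⟨⟨W', h1, h2⟩, h3, h4⟩
  choose g hg using hstep
  refine ⟨fun i => (g^[i] ⟨U, hU, hκU⟩).1, rfl, fun i => ?_⟩
  simp only [Function.iterate_succ_apply']
  exact ⟨(g^[i] _).2.1, (g^[i] _).2.2, hg _⟩

end Retract

/-- A component of a compact set missing a closed set has an open neighbourhood which misses the
closed set and is separated from the rest of the compact set. -/
theorem exists_separation_of_connectedComponentIn {K P : Set ℂ} (hK : IsCompact K)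
    (hP : IsClosed P) {x : ℂ} (hx : x ∈ K) (h : Disjoint (connectedComponentIn K x) P) :
    ∃ O₁ O₂ : Set ℂ, IsOpen O₁ ∧ IsOpen O₂ ∧ x ∈ O₁ ∧ Disjoint O₁ P ∧ Disjoint O₁ O₂ ∧
      K ⊆ O₁ ∪ O₂ := by
  have : CompactSpace K := isCompact_iff_compactSpace.1 hK
  have hP' : IsClosed ((↑) ⁻¹' P : Set K) := hP.preimage continuous_subtype_val
  have : Nonempty {s : Set K // IsClopen s ∧ (⟨x, hx⟩ : K) ∈ s} :=
    ⟨⟨univ, isClopen_univ, mem_univ _⟩⟩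
  obtain ⟨⟨s, hs, hxs⟩, hsP⟩ := hP'.isCompact.elim_directed_family_closed
    (fun s : {s : Set K // IsClopen s ∧ (⟨x, hx⟩ : K) ∈ s} => s.1) (fun s => s.2.1.isClosed) (by
      rw [← connectedComponent_eq_iInter_isClopen, eq_empty_iff_forall_notMem]
      rintro z ⟨hzP, hz⟩
      refine disjoint_left.1 h ?_ hzP
      rw [connectedComponentIn_eq_image hx]
      exact mem_image_of_mem _ hz)
    (fun a b => ⟨⟨a.1 ∩ b.1, a.2.1.inter b.2.1, a.2.2, b.2.2⟩, inter_subset_left,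
      inter_subset_right⟩)
  obtain ⟨O₁, O₂, h1, h2, hs1, hs2, h12⟩ := SeparatedNhds.of_isCompact_isCompact
    (hs.isClosed.isCompact.image continuous_subtype_val)
    (hs.compl.isClosed.isCompact.image continuous_subtype_val)
    ((disjoint_image_iff Subtype.val_injective).2 disjoint_compl_right)
  have hsP' : ∀ z : K, z ∈ s → (z : ℂ) ∉ P := fun z hz hzP =>
    eq_empty_iff_forall_notMem.1 hsP z ⟨hzP, hz⟩
  refine ⟨O₁ ∩ Pᶜ, O₂, h1.inter hP.isOpen_compl, h2, ⟨hs1 ⟨_, hxs, rfl⟩, hsP' _ hxs⟩,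
    disjoint_compl_left.mono_left inter_subset_right, h12.mono_left inter_subset_left, ?_⟩
  intro z hz
  by_cases hzs : (⟨z, hz⟩ : K) ∈ s
  · exact Or.inl ⟨hs1 ⟨_, hzs, rfl⟩, hsP' _ hzs⟩
  · exact Or.inr (hs2 ⟨_, hzs, rfl⟩)

theorem isOpen_diff_connectedComponentIn {U : Set ℂ} (hU : IsOpen U) (x : ℂ) :
    IsOpen (U \ connectedComponentIn U x) := by
  rw [isOpen_iff_mem_nhds]
  rintro z ⟨hzU, hz⟩
  filter_upwards [hU.connectedComponentIn.mem_nhds (mem_connectedComponentIn hzU)] with w hw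
  refine ⟨connectedComponentIn_subset _ _ hw, fun hw' => hz ?_⟩
  rw [connectedComponentIn_eq hw', ← connectedComponentIn_eq hw]
  exact mem_connectedComponentIn hzU

theorem exists_nhds_inter_image_subset {K O : Set ℂ} (hK : IsCompact K) (F : ℂ ≃ₜ ℂ)
    (hO : IsOpen O) (h : K ∩ F '' K ⊆ O) : ∃ U, IsOpen U ∧ K ⊆ U ∧ U ∩ F '' U ⊆ O := by
  have hN : IsOpen ({p : ℂ × ℂ | F p.1 = p.2}ᶜ ∪ {p : ℂ × ℂ | p.2 ∈ O}) :=
    (isClosed_setOf_apply_eq F).isOpen_compl.union (hO.preimage continuous_snd)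
  obtain ⟨u, v, hu, hv, hKu, hKv, huv⟩ := generalized_tube_lemma hK hK hN (by
    rintro ⟨z, w⟩ ⟨hz, hw⟩
    by_cases hzw : F z = w
    · exact Or.inr (h ⟨hw, z, hz, hzw⟩)
    · exact Or.inl hzw)
  refine ⟨u ∩ v, hu.inter hv, subset_inter hKu hKv, ?_⟩
  rintro _ ⟨hw, z, hz, rfl⟩
  rcases huv (show (z, F z) ∈ u ×ˢ v from ⟨hz.1, hw.2⟩) with h' | h'
  · exact absurd rfl h'
  · exact h'

theorem exists_tower {B : Type*} [TopologicalSpace B] [CompactSpace B] [T2Space B]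
    [ContractibleSpace B] {κ : B → ℂ} {ρ : ℂ → B} (hκ : Continuous κ) (hρ : Continuous ρ)
    (hκρ : ∀ z ∈ range κ, κ (ρ z) = z) (F : ℂ ≃ₜ ℂ) {x : ℂ}
    (hx : x ∈ range κ ∩ F '' range κ)
    (hfix : ∀ z ∈ connectedComponentIn (range κ ∩ F '' range κ) x, F z ≠ z) :
    ∃ D E Ω, Tower D E Ω ∧ (∀ i, F '' D i = E i) ∧
      (∀ i, connectedComponentIn (range κ ∩ F '' range κ) x ⊆ Ω i) ∧ ∀ z ∈ Ω 0, F z ≠ z := by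
  have hK : IsCompact (range κ) := isCompact_range hκ
  obtain ⟨O₁, O₂, hO₁, hO₂, hxO, hOP, hOO, hcov⟩ := exists_separation_of_connectedComponentIn
    (hK.inter (hK.image F.continuous)) (isClosed_eq F.continuous continuous_id) hx
    (disjoint_left.2 hfix)
  obtain ⟨U, hU, hKU, hUO⟩ := exists_nhds_inter_image_subset hK F (hO₁.union hO₂) hcov
  obtain ⟨D, rfl, hD⟩ := exists_seq_excludesTwoCycles hκ hρ hκρ hU hKU
  have hDo : ∀ i, IsOpen (D i) := fun i => (hD i).1
  have hEo : ∀ i, IsOpen (F '' D i) := fun i => F.isOpen_image.2 (hDo i)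
  have hDE : ∀ i, IsOpen (D i ∩ F '' D i) := fun i => (hDo i).inter (hEo i)
  have hKD : ∀ i, range κ ∩ F '' range κ ⊆ D i ∩ F '' D i := fun i =>
    inter_subset_inter (hD i).2.1 (image_mono (hD i).2.1)
  have hDa : Antitone D := antitone_nat_of_succ_le fun i => subset_closure.trans (hD i).2.2.1
  have hEa : Antitone fun i => F '' D i := fun i l hil => image_mono (hDa hil)
  set Ω : ℕ → Set ℂ := fun i => connectedComponentIn (D i ∩ F '' D i) x with hΩ
  have hΩsub : ∀ i, Ω i ⊆ D i ∩ F '' D i := fun i => connectedComponentIn_subset _ _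
  have hxΩ : ∀ i, x ∈ Ω i := fun i => mem_connectedComponentIn (hKD i hx)
  have hΩo : ∀ i, IsOpen (Ω i) := fun i => (hDE i).connectedComponentIn
  have hΩc : ∀ i, IsPreconnected (Ω i) := fun i => isPreconnected_connectedComponentIn
  refine ⟨D, fun i => F '' D i, Ω, ⟨hDo, hEo, hΩo, hDa, hEa, ?_, ?_, ?_, ?_, ?_, ?_⟩,
    fun i => rfl, fun i => connectedComponentIn_mono _ (hKD i), ?_⟩
  · exact fun i l hil => connectedComponentIn_mono _ (inter_subset_inter (hDa hil) (hEa hil))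
  · exact fun i => (hΩo i).isConnected_iff_isPathConnected.1 ⟨⟨x, hxΩ i⟩, hΩc i⟩
  · exact fun i => (hΩsub i).trans inter_subset_left
  · exact fun i => (hΩsub i).trans inter_subset_right
  · intro i
    refine (hΩc (i + 1)).closure.subset_connectedComponentIn (subset_closure (hxΩ _)) ?_
    refine (closure_mono (hΩsub _)).trans (closure_inter_subset.trans ?_)
    rw [← F.image_closure]
    exact inter_subset_inter (hD i).2.2.1 (image_mono (hD i).2.2.1)
  · intro G j hG hGD hGfix a ha b hb hab hba
    refine (hD j).2.2.2 G (Ω j) ((D j ∩ F '' D j) \ Ω j) (Ω (j + 1)) hG (hΩo j)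
      (isOpen_diff_connectedComponentIn (hDE j) x) disjoint_sdiff_right ?_ hGfix (hΩc _) ?_
      ((hΩsub _).trans inter_subset_left) ?_ a ha b hb hab hba
    · rw [hGD j (by omega)]
      intro z hz
      by_cases hzΩ : z ∈ Ω j
      exacts [Or.inl hzΩ, Or.inr ⟨hz, hzΩ⟩]
    · exact connectedComponentIn_mono _
        (inter_subset_inter (hDa (by omega)) (hEa (by omega)))
    · rw [hGD _ le_rfl]
      exact (hΩsub _).trans inter_subset_right
  · have h0 : Ω 0 ⊆ O₁ := (hΩc 0).subset_left_of_subset_union hO₁ hO₂ hOO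
      ((hΩsub 0).trans hUO) ⟨x, hxΩ 0, hxO⟩
    exact fun z hz hz' => disjoint_left.1 hOP (h0 hz) hz'

theorem exists_fixed_point_of_periodic_orbit {B : Type*} [TopologicalSpace B] [CompactSpace B]
    [T2Space B] [ContractibleSpace B] {κ : B → ℂ} {ρ : ℂ → B} (hκ : Continuous κ)
    (hρ : Continuous ρ) (hκρ : ∀ z ∈ range κ, κ (ρ z) = z) {F : ℂ ≃ₜ ℂ} (hF : HasSecantLog F)
    {x₀ x : ℂ} (hx₀ : x₀ ∈ range κ ∩ F '' range κ) {n : ℕ} (hn : 1 ≤ n)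
    (horb : ∀ i < n, F^[i] x ∈ connectedComponentIn (range κ ∩ F '' range κ) x₀)
    (hper : F^[n] x = x) :
    ∃ z ∈ connectedComponentIn (range κ ∩ F '' range κ) x₀, F z = z := by
  by_contra! hfix
  obtain ⟨D, E, Ω, T, hE, hΩ, hne⟩ := exists_tower hκ hρ hκρ F hx₀ hfix
  exact noCycle n hn D E Ω T 0 F ⟨hF, fun i _ => hE i, hne⟩ x
    (fun i hi => hΩ _ (horb i hi)) hper

/-- The plane of the statement as the complex plane. -/
def planeHomeomorph : Plane ≃ₜ ℂ := Complex.orthonormalBasisOneI.repr.toHomeomorph.symm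

theorem IsOrientationPreservingPlaneHomeo.hasSecantLog {F : Plane ≃ₜ Plane}
    (hF : IsOrientationPreservingPlaneHomeo F) :
    HasSecantLog ((planeHomeomorph.symm.trans F).trans planeHomeomorph) := by
  obtain ⟨H, hH, h0, h1, hb⟩ := hF
  refine hasSecantLog_of_isotopy
    (H := fun t z => planeHomeomorph (H t (planeHomeomorph.symm z))) ?_ ?_ ?_ ?_
  · exact planeHomeomorph.continuous.comp (hH.comp
      (continuous_fst.prodMk (planeHomeomorph.symm.continuous.comp continuous_snd)))
  · intro z
    simp [h0]
  · intro z
    simp [h1]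
  · exact fun t ht =>
      planeHomeomorph.injective.comp ((hb t ht).1.comp planeHomeomorph.symm.injective)

/-- Let `D` be a Jordan domain, `f : D → E` an orientation-preserving
homeomorphism onto its image, and `C` a connected component of `D ∩ E` containing a
periodic orbit of `f`. Then `f` has a fixed point in `C`. -/
theorem jordan_fixed_point_in_component (D E C : Set Plane) (f : Plane → Plane)
    (hD : IsJordanDomain D)
    (hf : IsHomeoOnto f D E)
    (hor : OrientationPreservingOn f D)
    (hC : ∃ x ∈ D ∩ E, C = connectedComponentIn (D ∩ E) x)
    (x : Plane) (n : ℕ) (hn : 1 ≤ n)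
    (horb : ∀ i < n, f^[i] x ∈ C)
    (hper : f^[n] x = x) :
    ∃ p ∈ C, f p = p := by
  obtain ⟨h⟩ := hD
  obtain ⟨F, hF, hfF⟩ := hor
  obtain ⟨x₀, hx₀, rfl⟩ := hC
  have hFE : F '' D = E := by rw [← hfF.image_eq, hf.2.2]
  set e := planeHomeomorph
  set G := (e.symm.trans F).trans e with hG
  have hGe : ∀ z, G (e z) = e (F z) := fun z => by simp [hG]
  let κ : Metric.closedBall (0 : Plane) 1 → ℂ := fun b => e (h.symm b)
  have hκ : Continuous κ := by fun_prop
  have hκi : Function.Injective κ :=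
    e.injective.comp (Subtype.val_injective.comp h.symm.injective)
  have hκD : range κ = e '' D := by
    change range (e ∘ Subtype.val ∘ h.symm) = _
    rw [range_comp, range_comp, h.symm.surjective.range_eq, image_univ, Subtype.range_coe]
  have : TietzeExtension.{0, 0} (Metric.closedBall (0 : Plane) 1) :=
    Set.instTietzeExtensionUnitClosedBall (𝕜 := ℝ)
  have : CompactSpace (Metric.closedBall (0 : Plane) 1) :=
    isCompact_iff_compactSpace.1 (isCompact_closedBall 0 1)
  have : ContractibleSpace (Metric.closedBall (0 : Plane) 1) :=
    (convex_closedBall 0 1).contractibleSpace ⟨0, Metric.mem_closedBall_self zero_le_one⟩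
  obtain ⟨ρ, hρ⟩ := ContinuousMap.exists_extension' (hκ.isClosedEmbedding hκi)
    (ContinuousMap.id (Metric.closedBall (0 : Plane) 1))
  have hK : range κ ∩ G '' range κ = e '' (D ∩ E) := by
    rw [hκD, image_inter e.injective, ← hFE, image_image, image_image]
    simp only [hGe]
  have hKc : connectedComponentIn (range κ ∩ G '' range κ) (e x₀) =
      e '' connectedComponentIn (D ∩ E) x₀ := by
    rw [hK, e.image_connectedComponentIn hx₀]
  have hiter : ∀ i ≤ n, G^[i] (e x) = e (f^[i] x) := by
    intro i hi
    induction i with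
    | zero => rfl
    | succ i ih =>
      rw [Function.iterate_succ_apply', Function.iterate_succ_apply', ih (by omega), hGe,
        hfF (connectedComponentIn_subset _ _ (horb i (by omega))).1]
  obtain ⟨z, hz, hGz⟩ := exists_fixed_point_of_periodic_orbit hκ ρ.continuous (by
    rintro _ ⟨b, rfl⟩
    exact congrArg κ (congrFun hρ b)) (F := G) hF.hasSecantLog (x₀ := e x₀) (x := e x)
    (hK ▸ mem_image_of_mem e hx₀) hn (fun i hi => by
      rw [hKc, hiter i hi.le]
      exact mem_image_of_mem e (horb i hi)) (by rw [hiter n le_rfl, hper])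
  rw [hKc] at hz
  obtain ⟨p, hp, rfl⟩ := hz
  rw [hGe] at hGz
  exact ⟨p, hp, by rw [hfF (connectedComponentIn_subset _ _ hp).1, e.injective hGz]⟩
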